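/- arXiv:0712.2549 — 3 statements merged into one kernel-verified Lean document; each statement's English description precedes it below -/
import Mathlib

section
/- The family of monomials {x₁^{a}x₂^{b}y₁^{c}y₂^{d} : a, b, c, d ∈ ℕ} (images in B(h)) is a basis of B(h) as a k-vector space. In particular, B(h) is a free left module with basis {y₁^{c}y₂^{d} : c, d ∈ ℕ} over its subalgebra generated by x₁, x₂, which is isomorphic to k⟨x₁,x₂⟩/(x₁x₂ + x₂x₁). -/
/-- The six defining relations of the algebra `B(h)`, on the free algebra on four
generators `x₁ = X 0`, `x₂ = X 1`, `y₁ = X 2`, `y₂ = X 3`. -/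
def bhRel (k : Type*) [Field k] (h : k) :
    FreeAlgebra k (Fin 4) → FreeAlgebra k (Fin 4) → Prop := fun a b =>
  (a = FreeAlgebra.ι k 1 * FreeAlgebra.ι k 0 ∧
    b = -(FreeAlgebra.ι k 0 * FreeAlgebra.ι k 1)) ∨
  (a = FreeAlgebra.ι k 3 * FreeAlgebra.ι k 2 ∧
    b = -(FreeAlgebra.ι k 2 * FreeAlgebra.ι k 3)) ∨
  (a = FreeAlgebra.ι k 2 * FreeAlgebra.ι k 0 ∧
    b = h • (FreeAlgebra.ι k 0 * FreeAlgebra.ι k 2 + FreeAlgebra.ι k 1 * FreeAlgebra.ι k 2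
      + FreeAlgebra.ι k 0 * FreeAlgebra.ι k 3)) ∨
  (a = FreeAlgebra.ι k 2 * FreeAlgebra.ι k 1 ∧
    b = h • (FreeAlgebra.ι k 0 * FreeAlgebra.ι k 3)) ∨
  (a = FreeAlgebra.ι k 3 * FreeAlgebra.ι k 0 ∧
    b = h • (FreeAlgebra.ι k 1 * FreeAlgebra.ι k 2)) ∨
  (a = FreeAlgebra.ι k 3 * FreeAlgebra.ι k 1 ∧
    b = h • (-(FreeAlgebra.ι k 1 * FreeAlgebra.ι k 2) - FreeAlgebra.ι k 0 * FreeAlgebra.ι k 3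
      + FreeAlgebra.ι k 1 * FreeAlgebra.ι k 3))

/-- The algebra `B(h)`: the quotient of `k⟨x₁,x₂,y₁,y₂⟩` by the two-sided ideal
generated by the six relations. -/
abbrev Bh (k : Type*) [Field k] (h : k) := RingQuot (bhRel k h)

/-- The generator `x₁` of `B(h)`. -/
def bX₁ (k : Type*) [Field k] (h : k) : Bh k h :=
  RingQuot.mkAlgHom k (bhRel k h) (FreeAlgebra.ι k 0)

/-- The generator `x₂` of `B(h)`. -/
def bX₂ (k : Type*) [Field k] (h : k) : Bh k h :=
  RingQuot.mkAlgHom k (bhRel k h) (FreeAlgebra.ι k 1)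

/-- The generator `y₁` of `B(h)`. -/
def bY₁ (k : Type*) [Field k] (h : k) : Bh k h :=
  RingQuot.mkAlgHom k (bhRel k h) (FreeAlgebra.ι k 2)

/-- The generator `y₂` of `B(h)`. -/
def bY₂ (k : Type*) [Field k] (h : k) : Bh k h :=
  RingQuot.mkAlgHom k (bhRel k h) (FreeAlgebra.ι k 3)


/-- The defining relation of `A = k⟨x₁,x₂⟩/(x₁x₂ + x₂x₁)`. -/
def aRel (k : Type*) [Field k] :
    FreeAlgebra k (Fin 2) → FreeAlgebra k (Fin 2) → Prop := fun a b =>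
  a = FreeAlgebra.ι k 0 * FreeAlgebra.ι k 1 + FreeAlgebra.ι k 1 * FreeAlgebra.ι k 0 ∧ b = 0

/-- The algebra `A = k⟨x₁,x₂⟩/(x₁x₂ + x₂x₁)`. -/
abbrev Aq (k : Type*) [Field k] := RingQuot (aRel k)

/-- The generator `x₁` of `A`. -/
def aX₁ (k : Type*) [Field k] : Aq k :=
  RingQuot.mkAlgHom k (aRel k) (FreeAlgebra.ι k 0)

/-- The generator `x₂` of `A`. -/
def aX₂ (k : Type*) [Field k] : Aq k :=
  RingQuot.mkAlgHom k (aRel k) (FreeAlgebra.ι k 1)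

open TensorProduct

section MonomialBasis

section Presentation

variable {k : Type*} [Field k]

/-- Induction principle for quotients of free algebras. -/
theorem RingQuot.freeAlgebra_induction {X : Type*}
    {r : FreeAlgebra k X → FreeAlgebra k X → Prop} {P : RingQuot r → Prop}
    (scalar : ∀ c : k, P (algebraMap k _ c))
    (gen : ∀ x, P (RingQuot.mkAlgHom k r (FreeAlgebra.ι k x)))
    (mul : ∀ a b, P a → P b → P (a * b)) (add : ∀ a b, P a → P b → P (a + b))
    (a : RingQuot r) : P a := by
  obtain ⟨a, rfl⟩ := RingQuot.mkAlgHom_surjective k r a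
  induction a using FreeAlgebra.induction with
  | grade0 c => simpa using scalar c
  | grade1 x => exact gen x
  | mul a b ha hb => simpa using mul _ _ ha hb
  | add a b ha hb => simpa using add _ _ ha hb

end Presentation

/-- The ring structure on a quotient of a free algebra; unlike the general instance, it extends
`RingQuot.instSemiring` up to reducible unfolding. -/
noncomputable local instance RingQuot.instRingFreeAlgebra {k : Type*} [Field k] {X : Type*}
    (r : FreeAlgebra k X → FreeAlgebra k X → Prop) : Ring (RingQuot r) :=
  Algebra.semiringToRing k

noncomputable local instance RingQuot.instNegFreeAlgebra {k : Type*} [Field k] {X : Type*}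
    (r : FreeAlgebra k X → FreeAlgebra k X → Prop) : Neg (RingQuot r) :=
  Ring.toNeg

noncomputable local instance RingQuot.instSubFreeAlgebra {k : Type*} [Field k] {X : Type*}
    (r : FreeAlgebra k X → FreeAlgebra k X → Prop) : Sub (RingQuot r) :=
  Ring.toSub

section Ring

variable {k : Type*} [Field k] {T : Type*} [Ring T] [Algebra k T]

theorem mul_pow_of_mul_eq_neg {u v : T} (huv : v * u = -(u * v)) (a : ℕ) :
    v * u ^ a = (-1 : k) ^ a • (u ^ a * v) := by
  induction a with
  | zero => simp
  | succ a ih =>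
    rw [pow_succ, ← mul_assoc, ih, smul_mul_assoc, mul_assoc, huv, mul_neg,
      ← mul_assoc, pow_succ, mul_neg_one, neg_smul, smul_neg]

theorem mul_add_mul_matrix_eq_zero {u v : T} (huv : v * u = -(u * v)) (h : k) :
    (h • !![u + v, u; v, 0]) * (h • !![0, u; -v, v - u]) +
      (h • !![0, u; -v, v - u]) * (h • !![u + v, u; v, 0]) = 0 := by
  simp only [smul_mul_smul_comm, ← smul_add]
  convert smul_zero (h * h)
  ext i j
  fin_cases i <;> fin_cases j <;> simp [mul_add, add_mul, mul_sub, sub_mul, huv]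
  all_goals abel

end Ring

namespace Aq

variable {k : Type*} [Field k]

theorem induction {P : Aq k → Prop} (scalar : ∀ c : k, P (algebraMap k _ c))
    (x₁ : P (aX₁ k)) (x₂ : P (aX₂ k))
    (mul : ∀ a b, P a → P b → P (a * b)) (add : ∀ a b, P a → P b → P (a + b))
    (a : Aq k) : P a := by
  refine RingQuot.freeAlgebra_induction scalar (fun x => ?_) mul add a
  fin_cases x
  · exact x₁
  · exact x₂

variable (k) in
theorem adjoin_eq_top : Algebra.adjoin k {aX₁ k, aX₂ k} = ⊤ := by
  refine eq_top_iff.2 fun a _ => ?_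
  induction a using induction with
  | scalar c => exact Subalgebra.algebraMap_mem _ c
  | x₁ => exact Algebra.subset_adjoin (by simp)
  | x₂ => exact Algebra.subset_adjoin (by simp)
  | mul a b ha hb => exact mul_mem (ha trivial) (hb trivial)
  | add a b ha hb => exact add_mem (ha trivial) (hb trivial)

theorem aX₁_mul_aX₂_add : aX₁ k * aX₂ k + aX₂ k * aX₁ k = 0 := by
  have := RingQuot.mkAlgHom_rel k (s := aRel k) ⟨rfl, rfl⟩
  simpa [aX₁, aX₂] using this

theorem aX₂_mul_aX₁ : aX₂ k * aX₁ k = -(aX₁ k * aX₂ k) :=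
  eq_neg_of_add_eq_zero_right aX₁_mul_aX₂_add

/-- The universal property of `A`. -/
noncomputable def lift {T : Type*} [Ring T] [Algebra k T] (u v : T) (huv : u * v + v * u = 0) :
    Aq k →ₐ[k] T :=
  RingQuot.liftAlgHom k ⟨FreeAlgebra.lift k ![u, v], by
    rintro _ _ ⟨rfl, rfl⟩
    simpa using huv⟩

section

variable {T : Type*} [Ring T] [Algebra k T] {u v : T} (huv : u * v + v * u = 0)

@[simp]
theorem lift_aX₁ : lift u v huv (aX₁ k) = u := by
  simp [lift, aX₁]

@[simp]
theorem lift_aX₂ : lift u v huv (aX₂ k) = v := by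
  simp [lift, aX₂]

end

/-- The standard monomials of `A`. -/
noncomputable def monomial (k : Type*) [Field k] (n : ℕ × ℕ) : Aq k := aX₁ k ^ n.1 * aX₂ k ^ n.2

variable (k) in
/-- Multiplication by `x₁` on the space with basis indexed by the standard monomials. -/
noncomputable def opX₁ : Module.End k (ℕ × ℕ →₀ k) :=
  Finsupp.linearCombination k fun n => Finsupp.single (n.1 + 1, n.2) 1

variable (k) in
/-- Multiplication by `x₂` on the space with basis indexed by the standard monomials. -/
noncomputable def opX₂ : Module.End k (ℕ × ℕ →₀ k) :=
  Finsupp.linearCombination k fun n => Finsupp.single (n.1, n.2 + 1) ((-1) ^ n.1)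

theorem opX₁_mul_opX₂_add : opX₁ k * opX₂ k + opX₂ k * opX₁ k = 0 := by
  ext n : 2
  simp [opX₁, opX₂, pow_succ]

variable (k) in
/-- The representation of `A` on the space with basis indexed by the standard monomials. -/
noncomputable def rep : Aq k →ₐ[k] Module.End k (ℕ × ℕ →₀ k) :=
  lift (opX₁ k) (opX₂ k) opX₁_mul_opX₂_add

theorem rep_monomial (n : ℕ × ℕ) :
    rep k (monomial k n) (Finsupp.single (0, 0) 1) = Finsupp.single n 1 := by
  obtain ⟨a, b⟩ := n
  have h₂ : (opX₂ k ^ b) (Finsupp.single (0, 0) 1) = Finsupp.single (0, b) 1 := by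
    induction b with
    | zero => simp
    | succ b ih => rw [pow_succ', Module.End.mul_apply, ih]; simp [opX₂]
  have h₁ : (opX₁ k ^ a) (Finsupp.single (0, b) 1) = Finsupp.single (a, b) 1 := by
    induction a with
    | zero => simp
    | succ a ih => rw [pow_succ', Module.End.mul_apply, ih]; simp [opX₁]
  simp [rep, monomial, h₂, h₁]

theorem linearIndependent_monomial : LinearIndependent k (monomial k) := by
  let f : Aq k →ₗ[k] (ℕ × ℕ →₀ k) :=
    LinearMap.applyₗ (Finsupp.single (0, 0) 1) ∘ₗ (rep k).toLinearMap
  refine LinearIndependent.of_comp f ?_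
  have : f ∘ monomial k = fun n => Finsupp.single n 1 := funext rep_monomial
  rw [this]
  exact Finsupp.linearIndependent_single_one k _

theorem aX₂_mul_monomial (n : ℕ × ℕ) :
    aX₂ k * monomial k n = (-1 : k) ^ n.1 • monomial k (n.1, n.2 + 1) := by
  obtain ⟨a, b⟩ := n
  simp only [monomial]
  rw [← mul_assoc, mul_pow_of_mul_eq_neg (k := k) aX₂_mul_aX₁, smul_mul_assoc, mul_assoc, ← pow_succ']

theorem span_monomial : ⊤ ≤ Submodule.span k (Set.range (monomial k)) := by
  set S := Submodule.span k (Set.range (monomial k)) with hS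
  have key : ∀ a : Aq k, ∀ s ∈ S, a * s ∈ S := by
    intro a
    induction a using induction with
    | scalar c => intro s hs; rw [← Algebra.smul_def]; exact S.smul_mem c hs
    | x₁ =>
      intro s hs
      induction hs using Submodule.span_induction with
      | mem x hx =>
        obtain ⟨n, rfl⟩ := hx
        have : aX₁ k * monomial k n = monomial k (n.1 + 1, n.2) := by
          simp only [monomial]
          rw [← mul_assoc, ← pow_succ']
        rw [this]
        exact Submodule.subset_span ⟨_, rfl⟩
      | zero => simp
      | add x y _ _ hx hy => rw [mul_add]; exact S.add_mem hx hy
      | smul c x _ hx => rw [mul_smul_comm]; exact S.smul_mem c hx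
    | x₂ =>
      intro s hs
      induction hs using Submodule.span_induction with
      | mem x hx =>
        obtain ⟨n, rfl⟩ := hx
        rw [aX₂_mul_monomial]
        exact S.smul_mem _ (Submodule.subset_span ⟨_, rfl⟩)
      | zero => simp
      | add x y _ _ hx hy => rw [mul_add]; exact S.add_mem hx hy
      | smul c x _ hx => rw [mul_smul_comm]; exact S.smul_mem c hx
    | mul a b ha hb => intro s hs; rw [mul_assoc]; exact ha _ (hb _ hs)
    | add a b ha hb => intro s hs; rw [add_mul]; exact S.add_mem (ha _ hs) (hb _ hs)
  intro a _
  simpa using key a 1 (Submodule.subset_span ⟨(0, 0), by simp [monomial]⟩)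

variable (k) in
/-- The basis of `A` formed by the standard monomials. -/
noncomputable def basis : Module.Basis (ℕ × ℕ) k (Aq k) :=
  Module.Basis.mk linearIndependent_monomial span_monomial

@[simp]
theorem basis_apply (n : ℕ × ℕ) : basis k n = aX₁ k ^ n.1 * aX₂ k ^ n.2 := by
  simp [basis, monomial]

/-- The homomorphism `σ : A → M₂(A)` that governs moving `y₁, y₂` past elements of `A`. -/
noncomputable def sigma (h : k) : Aq k →ₐ[k] Matrix (Fin 2) (Fin 2) (Aq k) :=
  lift _ _ (mul_add_mul_matrix_eq_zero aX₂_mul_aX₁ h)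

@[simp]
theorem sigma_aX₁ (h : k) : sigma h (aX₁ k) = h • !![aX₁ k + aX₂ k, aX₁ k; aX₂ k, 0] :=
  lift_aX₁ _

@[simp]
theorem sigma_aX₂ (h : k) :
    sigma h (aX₂ k) = h • !![0, aX₁ k; -aX₂ k, aX₂ k - aX₁ k] :=
  lift_aX₂ _

end Aq

section TwistedTensor

variable {k : Type*} [Field k] {A C : Type*} [Ring A] [Algebra k A] [Ring C] [Algebra k C]

/-- The operator `a ⊗ c ↦ ∑ j, σᵢⱼ(a) ⊗ yⱼ c` on `A ⊗ C`. -/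
noncomputable def twistedMul (σ : A →ₐ[k] Matrix (Fin 2) (Fin 2) A) (y : Fin 2 → C) (i : Fin 2) :
    Module.End k (A ⊗[k] C) :=
  ∑ j, TensorProduct.map (Matrix.entryLinearMap k A i j ∘ₗ σ.toLinearMap)
    (LinearMap.mulLeft k (y j))

@[simp]
theorem twistedMul_tmul (σ : A →ₐ[k] Matrix (Fin 2) (Fin 2) A) (y : Fin 2 → C) (i : Fin 2)
    (a : A) (c : C) :
    twistedMul σ y i (a ⊗ₜ c) = σ a i 0 ⊗ₜ (y 0 * c) + σ a i 1 ⊗ₜ (y 1 * c) := by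
  simp [twistedMul, Fin.sum_univ_two]

theorem twistedMul_mul_lsmul (σ : A →ₐ[k] Matrix (Fin 2) (Fin 2) A) (y : Fin 2 → C) (i : Fin 2)
    (a : A) :
    twistedMul σ y i * Algebra.lsmul k k (A ⊗[k] C) a =
      Algebra.lsmul k k (A ⊗[k] C) (σ a i 0) * twistedMul σ y 0 +
        Algebra.lsmul k k (A ⊗[k] C) (σ a i 1) * twistedMul σ y 1 := by
  refine TensorProduct.ext' fun b c => ?_
  simp [TensorProduct.smul_tmul', Matrix.mul_apply, Fin.sum_univ_two, TensorProduct.add_tmul]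
  abel

end TwistedTensor

/-- The relations of `B(h)` on four elements of a `k`-algebra. -/
structure BhRelations {k : Type*} [Field k] (h : k) {T : Type*} [Ring T] [Algebra k T]
    (x₁ x₂ y₁ y₂ : T) : Prop where
  x₂_mul_x₁ : x₂ * x₁ = -(x₁ * x₂)
  y₂_mul_y₁ : y₂ * y₁ = -(y₁ * y₂)
  y₁_mul_x₁ : y₁ * x₁ = h • (x₁ * y₁ + x₂ * y₁ + x₁ * y₂)
  y₁_mul_x₂ : y₁ * x₂ = h • (x₁ * y₂)
  y₂_mul_x₁ : y₂ * x₁ = h • (x₂ * y₁)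
  y₂_mul_x₂ : y₂ * x₂ = h • (-(x₂ * y₁) - x₁ * y₂ + x₂ * y₂)

section Ring

variable {k : Type*} [Field k] {h : k} {T : Type*} [Ring T] [Algebra k T] {x₁ x₂ y₁ y₂ : T}
  (h₁₁ : y₁ * x₁ = h • (x₁ * y₁ + x₂ * y₁ + x₁ * y₂))
  (h₁₂ : y₁ * x₂ = h • (x₁ * y₂))
  (h₂₁ : y₂ * x₁ = h • (x₂ * y₁))
  (h₂₂ : y₂ * x₂ = h • (-(x₂ * y₁) - x₁ * y₂ + x₂ * y₂))

include h₁₁ h₁₂ h₂₁ h₂₂ in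
theorem anticommutator_mul_x₁ :
    (y₂ * y₁ + y₁ * y₂) * x₁ = (h * h) • (x₂ * (y₂ * y₁ + y₁ * y₂)) := by
  have e₁ : ∀ t, y₁ * (x₁ * t) = h • (x₁ * (y₁ * t) + x₂ * (y₁ * t) + x₁ * (y₂ * t)) := by
    intro t; rw [← mul_assoc, h₁₁]; simp [add_mul, mul_assoc]
  have e₂ : ∀ t, y₁ * (x₂ * t) = h • (x₁ * (y₂ * t)) := by
    intro t; rw [← mul_assoc, h₁₂]; simp [mul_assoc]
  have e₃ : ∀ t, y₂ * (x₁ * t) = h • (x₂ * (y₁ * t)) := by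
    intro t; rw [← mul_assoc, h₂₁]; simp [mul_assoc]
  have e₄ : ∀ t, y₂ * (x₂ * t) = h • (-(x₂ * (y₁ * t)) - x₁ * (y₂ * t) + x₂ * (y₂ * t)) := by
    intro t; rw [← mul_assoc, h₂₂]; simp [add_mul, sub_mul, mul_assoc]
  simp only [add_mul, mul_add, mul_assoc, h₁₁, h₂₁, mul_smul_comm, e₂, e₃, e₄, smul_smul,
    ← smul_add]
  congr 1
  abel

include h₁₁ h₁₂ h₂₁ h₂₂ in
theorem anticommutator_mul_x₂ :
    (y₂ * y₁ + y₁ * y₂) * x₂ = (h * h) • -(x₁ * (y₂ * y₁ + y₁ * y₂)) := by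
  have e₁ : ∀ t, y₁ * (x₁ * t) = h • (x₁ * (y₁ * t) + x₂ * (y₁ * t) + x₁ * (y₂ * t)) := by
    intro t; rw [← mul_assoc, h₁₁]; simp [add_mul, mul_assoc]
  have e₂ : ∀ t, y₁ * (x₂ * t) = h • (x₁ * (y₂ * t)) := by
    intro t; rw [← mul_assoc, h₁₂]; simp [mul_assoc]
  have e₃ : ∀ t, y₂ * (x₁ * t) = h • (x₂ * (y₁ * t)) := by
    intro t; rw [← mul_assoc, h₂₁]; simp [mul_assoc]
  simp only [add_mul, mul_add, mul_sub, mul_neg, mul_assoc, h₁₂, h₂₂, mul_smul_comm, e₁, e₂, e₃,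
    smul_smul, ← smul_add, ← smul_sub, ← smul_neg]
  congr 1
  abel

end Ring

section TwistedTensorRelations

variable {k : Type*} [Field k] {h : k} {A : Type*} [Ring A] [Algebra k A] {u v : A}
  {σ : A →ₐ[k] Matrix (Fin 2) (Fin 2) A}

theorem bhRelations_twistedMul (huv : v * u = -(u * v)) (hA : Algebra.adjoin k {u, v} = ⊤)
    (hu : σ u = h • !![u + v, u; v, 0]) (hv : σ v = h • !![0, u; -v, v - u]) :
    BhRelations h (Algebra.lsmul k k (A ⊗[k] A) u) (Algebra.lsmul k k (A ⊗[k] A) v)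
      (twistedMul σ ![u, v] 0) (twistedMul σ ![u, v] 1) := by
  set L := Algebra.lsmul (A := A) k k (A ⊗[k] A) with hL
  set Y := twistedMul σ ![u, v] with hY
  have hYL : ∀ i a, Y i * L a = L (σ a i 0) * Y 0 + L (σ a i 1) * Y 1 :=
    fun i a => twistedMul_mul_lsmul σ _ i a
  have h₁₁ : Y 0 * L u = h • (L u * Y 0 + L v * Y 0 + L u * Y 1) := by
    simp [hYL, hu, add_mul]
  have h₁₂ : Y 0 * L v = h • (L u * Y 1) := by simp [hYL, hv]
  have h₂₁ : Y 1 * L u = h • (L v * Y 0) := by simp [hYL, hu]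
  have h₂₂ : Y 1 * L v = h • (-(L v * Y 0) - L u * Y 1 + L v * Y 1) := by
    have e₁ : L (-v) * Y 0 = -(L v * Y 0) := by rw [map_neg]; exact neg_mul (L v) (Y 0)
    have e₂ : L (v - u) * Y 1 = L v * Y 1 - L u * Y 1 := by rw [map_sub]; exact sub_mul _ _ _
    simp only [hYL, hv, Matrix.smul_apply, Matrix.of_apply, Matrix.cons_val_zero,
      Matrix.cons_val_one, map_smul, smul_mul_assoc, e₁, e₂]
    module
  have key : ∀ a m, (Y 1 * Y 0 + Y 0 * Y 1) m = 0 → (Y 1 * Y 0 + Y 0 * Y 1) (L a m) = 0 := by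
    intro a
    have ha : a ∈ Algebra.adjoin k {u, v} := hA ▸ Algebra.mem_top
    induction ha using Algebra.adjoin_induction with
    | mem x hx =>
      intro m hm
      obtain rfl | rfl := hx
      · rw [← Module.End.mul_apply, anticommutator_mul_x₁ h₁₁ h₁₂ h₂₁ h₂₂, LinearMap.smul_apply,
          Module.End.mul_apply, hm, map_zero, smul_zero]
      · rw [← Module.End.mul_apply, anticommutator_mul_x₂ h₁₁ h₁₂ h₂₁ h₂₂, LinearMap.smul_apply,
          LinearMap.neg_apply, Module.End.mul_apply, hm, map_zero, neg_zero, smul_zero]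
    | algebraMap c =>
      intro m hm
      rw [AlgHom.commutes, Module.algebraMap_end_apply, map_smul, hm, smul_zero]
    | mul a b _ _ ha hb => intro m hm; rw [map_mul, Module.End.mul_apply]; exact ha _ (hb _ hm)
    | add a b _ _ ha hb =>
      intro m hm
      rw [map_add L, LinearMap.add_apply (L a), map_add (Y 1 * Y 0 + Y 0 * Y 1), ha _ hm, hb _ hm,
        add_zero]
  have hZ : Y 1 * Y 0 + Y 0 * Y 1 = 0 := by
    refine TensorProduct.ext' fun a c => ?_
    have := key a (1 ⊗ₜ c) (by
      simp [hY, ← TensorProduct.tmul_add, ← mul_assoc, huv])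
    simpa [hL, TensorProduct.smul_tmul'] using this
  exact ⟨by rw [← map_mul, ← map_mul, ← map_neg, huv], eq_neg_of_add_eq_zero_left hZ,
    h₁₁, h₁₂, h₂₁, h₂₂⟩

end TwistedTensorRelations

namespace Bh

variable {k : Type*} [Field k] {h : k}

theorem induction {P : Bh k h → Prop} (scalar : ∀ c : k, P (algebraMap k _ c))
    (x₁ : P (bX₁ k h)) (x₂ : P (bX₂ k h)) (y₁ : P (bY₁ k h)) (y₂ : P (bY₂ k h))
    (mul : ∀ a b, P a → P b → P (a * b)) (add : ∀ a b, P a → P b → P (a + b))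
    (a : Bh k h) : P a := by
  refine RingQuot.freeAlgebra_induction scalar (fun x => ?_) mul add a
  fin_cases x
  · exact x₁
  · exact x₂
  · exact y₁
  · exact y₂

variable (k h) in
theorem relations : BhRelations h (bX₁ k h) (bX₂ k h) (bY₁ k h) (bY₂ k h) where
  x₂_mul_x₁ := by
    have := RingQuot.mkAlgHom_rel k (s := bhRel k h) (.inl ⟨rfl, rfl⟩)
    rwa [map_neg, map_mul, map_mul] at this
  y₂_mul_y₁ := by
    have := RingQuot.mkAlgHom_rel k (s := bhRel k h) (.inr <| .inl ⟨rfl, rfl⟩)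
    rwa [map_neg, map_mul, map_mul] at this
  y₁_mul_x₁ := by
    have := RingQuot.mkAlgHom_rel k (s := bhRel k h) (.inr <| .inr <| .inl ⟨rfl, rfl⟩)
    simpa only [bX₁, bX₂, bY₁, bY₂, map_smul, map_add, map_mul] using this
  y₁_mul_x₂ := by
    have := RingQuot.mkAlgHom_rel k (s := bhRel k h) (.inr <| .inr <| .inr <| .inl ⟨rfl, rfl⟩)
    simpa only [bX₁, bX₂, bY₁, bY₂, map_smul, map_add, map_mul] using this
  y₂_mul_x₁ := by
    have := RingQuot.mkAlgHom_rel k (s := bhRel k h)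
      (.inr <| .inr <| .inr <| .inr <| .inl ⟨rfl, rfl⟩)
    simpa only [bX₁, bX₂, bY₁, bY₂, map_smul, map_add, map_mul] using this
  y₂_mul_x₂ := by
    have := RingQuot.mkAlgHom_rel k (s := bhRel k h)
      (.inr <| .inr <| .inr <| .inr <| .inr ⟨rfl, rfl⟩)
    simpa only [bX₁, bX₂, bY₁, bY₂, map_smul, map_add, map_sub, map_neg, map_mul] using this

section Lift

variable {T : Type*} [Ring T] [Algebra k T] {x₁ x₂ y₁ y₂ : T} (H : BhRelations h x₁ x₂ y₁ y₂)

/-- The universal property of `B(h)`. -/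
noncomputable def lift : Bh k h →ₐ[k] T :=
  RingQuot.liftAlgHom k ⟨FreeAlgebra.lift k ![x₁, x₂, y₁, y₂], by
    rintro _ _ (⟨rfl, rfl⟩ | ⟨rfl, rfl⟩ | ⟨rfl, rfl⟩ | ⟨rfl, rfl⟩ | ⟨rfl, rfl⟩ | ⟨rfl, rfl⟩)
    · simpa using H.x₂_mul_x₁
    · simpa using H.y₂_mul_y₁
    · simpa using H.y₁_mul_x₁
    · simpa using H.y₁_mul_x₂
    · simpa using H.y₂_mul_x₁
    · simpa using H.y₂_mul_x₂⟩

@[simp]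
theorem lift_bX₁ : lift H (bX₁ k h) = x₁ := by
  simp [lift, bX₁]

@[simp]
theorem lift_bX₂ : lift H (bX₂ k h) = x₂ := by
  simp [lift, bX₂]

@[simp]
theorem lift_bY₁ : lift H (bY₁ k h) = y₁ := by
  simp [lift, bY₁]

@[simp]
theorem lift_bY₂ : lift H (bY₂ k h) = y₂ := by
  simp [lift, bY₂]

end Lift

/-- Left multiplication by `x₁, x₂` on `A ⊗ A`. -/
noncomputable def opX : Aq k →ₐ[k] Module.End k (Aq k ⊗[k] Aq k) :=
  Algebra.lsmul k k (Aq k ⊗[k] Aq k)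

@[simp]
theorem opX_tmul (a b c : Aq k) : opX a (b ⊗ₜ c) = (a * b) ⊗ₜ[k] c := rfl

variable (h) in
/-- Left multiplication by `y₁, y₂` on `A ⊗ A`. -/
noncomputable def opY (i : Fin 2) : Module.End k (Aq k ⊗[k] Aq k) :=
  twistedMul (Aq.sigma h) ![aX₁ k, aX₂ k] i

theorem opY_tmul (i : Fin 2) (a c : Aq k) :
    opY h i (a ⊗ₜ[k] c) =
      Aq.sigma h a i 0 ⊗ₜ (aX₁ k * c) + Aq.sigma h a i 1 ⊗ₜ (aX₂ k * c) :=
  twistedMul_tmul _ _ _ _ _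

theorem opY_one_tmul (i : Fin 2) (c : Aq k) :
    opY h i (1 ⊗ₜ[k] c) = 1 ⊗ₜ (![aX₁ k, aX₂ k] i * c) := by
  fin_cases i <;> simp [opY_tmul]

variable (k h) in
theorem opRelations :
    BhRelations h (opX (aX₁ k)) (opX (aX₂ k)) (opY (k := k) h 0) (opY h 1) :=
  bhRelations_twistedMul Aq.aX₂_mul_aX₁ (Aq.adjoin_eq_top k) (Aq.sigma_aX₁ h) (Aq.sigma_aX₂ h)

variable (k h) in
/-- The representation of `B(h)` on `A ⊗ A`. -/
noncomputable def rep : Bh k h →ₐ[k] Module.End k (Aq k ⊗[k] Aq k) :=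
  lift (opRelations k h)

variable (k h) in
/-- The homomorphism `A → B(h)` onto the subalgebra generated by `x₁, x₂`. -/
noncomputable def inclX : Aq k →ₐ[k] Bh k h :=
  Aq.lift (bX₁ k h) (bX₂ k h) (by rw [(relations k h).x₂_mul_x₁]; exact add_neg_cancel _)

variable (k h) in
/-- The homomorphism `A → B(h)` onto the subalgebra generated by `y₁, y₂`. -/
noncomputable def inclY : Aq k →ₐ[k] Bh k h :=
  Aq.lift (bY₁ k h) (bY₂ k h) (by rw [(relations k h).y₂_mul_y₁]; exact add_neg_cancel _)

variable (k h) in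
/-- The multiplication map `a ⊗ c ↦ a(x₁, x₂) c(y₁, y₂)`. -/
noncomputable def ofTensor : Aq k ⊗[k] Aq k →ₗ[k] Bh k h :=
  LinearMap.mul' k (Bh k h) ∘ₗ
    TensorProduct.map (inclX k h).toLinearMap (inclY k h).toLinearMap

@[simp]
theorem ofTensor_tmul (a c : Aq k) : ofTensor k h (a ⊗ₜ c) = inclX k h a * inclY k h c := rfl

theorem rep_inclX (a : Aq k) : rep k h (inclX k h a) = opX a := by
  induction a using Aq.induction with
  | scalar c => simp only [AlgHom.commutes]
  | x₁ => simp [rep, inclX]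
  | x₂ => simp [rep, inclX]
  | mul a b ha hb => simp only [map_mul, ha, hb]
  | add a b ha hb => simp only [map_add, ha, hb]

theorem rep_inclY (c : Aq k) : ∀ c', rep k h (inclY k h c) (1 ⊗ₜ c') = 1 ⊗ₜ (c * c') := by
  induction c using Aq.induction with
  | scalar r =>
    intro c'
    rw [AlgHom.commutes, AlgHom.commutes, Module.algebraMap_end_apply, ← Algebra.smul_def,
      TensorProduct.tmul_smul]
  | x₁ => simp [rep, inclY, opY_one_tmul]
  | x₂ => simp [rep, inclY, opY_one_tmul]
  | mul a b ha hb =>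
    intro c'
    rw [map_mul, map_mul, Module.End.mul_apply, hb, ha, mul_assoc]
  | add a b ha hb =>
    intro c'
    rw [map_add, map_add, LinearMap.add_apply, hb, ha, add_mul, TensorProduct.tmul_add]

theorem rep_ofTensor (m : Aq k ⊗[k] Aq k) : rep k h (ofTensor k h m) (1 ⊗ₜ 1) = m := by
  induction m using TensorProduct.induction_on with
  | zero => simp
  | tmul a c =>
    rw [ofTensor_tmul, map_mul, Module.End.mul_apply, rep_inclY, rep_inclX, opX_tmul, mul_one,
      mul_one]
  | add m n hm hn => rw [map_add, map_add, LinearMap.add_apply, hm, hn]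

theorem bY_mul_inclX (a : Aq k) : ∀ i, ![bY₁ k h, bY₂ k h] i * inclX k h a =
    inclX k h (Aq.sigma h a i 0) * bY₁ k h + inclX k h (Aq.sigma h a i 1) * bY₂ k h := by
  have R := relations k h
  induction a using Aq.induction with
  | scalar c =>
    intro i
    rw [AlgHom.commutes, AlgHom.commutes, ← Algebra.commutes, Matrix.algebraMap_matrix_apply,
      Matrix.algebraMap_matrix_apply]
    fin_cases i <;> simp
  | x₁ =>
    intro i
    fin_cases i
    · simpa [inclX, add_mul] using R.y₁_mul_x₁
    · simpa [inclX, add_mul] using R.y₂_mul_x₁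
  | x₂ =>
    intro i
    fin_cases i
    · simpa [inclX, add_mul] using R.y₁_mul_x₂
    · have := R.y₂_mul_x₂
      simp [inclX, sub_mul] at this ⊢
      rw [this]
      module
  | mul a b ha hb =>
    intro i
    have h₀ := hb 0
    have h₁ := hb 1
    simp only [Matrix.cons_val_zero, Matrix.cons_val_one] at h₀ h₁
    rw [map_mul, ← mul_assoc, ha, add_mul, mul_assoc, h₀, mul_assoc, h₁, map_mul,
      Matrix.mul_apply, Matrix.mul_apply]
    simp only [Fin.sum_univ_two, map_add, map_mul, mul_add, add_mul, mul_assoc]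
    abel
  | add a b ha hb =>
    intro i
    rw [map_add, mul_add, ha, hb, map_add, Matrix.add_apply, Matrix.add_apply, map_add, map_add,
      add_mul, add_mul]
    abel

theorem ofTensor_opX (a : Aq k) (m : Aq k ⊗[k] Aq k) :
    ofTensor k h (opX a m) = inclX k h a * ofTensor k h m := by
  induction m using TensorProduct.induction_on with
  | zero => simp
  | tmul b c => rw [opX_tmul, ofTensor_tmul, ofTensor_tmul, map_mul, mul_assoc]
  | add m n hm hn => rw [map_add, map_add, hm, hn, map_add, mul_add]

theorem ofTensor_opY (i : Fin 2) (m : Aq k ⊗[k] Aq k) :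
    ofTensor k h (opY h i m) = ![bY₁ k h, bY₂ k h] i * ofTensor k h m := by
  induction m using TensorProduct.induction_on with
  | zero => simp
  | tmul a c =>
    rw [opY_tmul, map_add, ofTensor_tmul, ofTensor_tmul, ofTensor_tmul, ← mul_assoc, bY_mul_inclX,
      map_mul, map_mul, add_mul, mul_assoc, mul_assoc]
    simp [inclY]
  | add m n hm hn => rw [map_add, map_add, hm, hn, map_add, mul_add]

theorem ofTensor_rep (b : Bh k h) :
    ∀ m, ofTensor k h (rep k h b m) = b * ofTensor k h m := by
  induction b using Bh.induction with
  | scalar c =>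
    intro m
    rw [AlgHom.commutes, Module.algebraMap_end_apply, map_smul, Algebra.smul_def]
  | x₁ => intro m; simp [rep, ofTensor_opX, inclX]
  | x₂ => intro m; simp [rep, ofTensor_opX, inclX]
  | y₁ => intro m; simp [rep, ofTensor_opY]
  | y₂ => intro m; simp [rep, ofTensor_opY]
  | mul a b ha hb =>
    intro m
    rw [map_mul, Module.End.mul_apply, ha, hb, mul_assoc]
  | add a b ha hb =>
    intro m
    rw [map_add, LinearMap.add_apply, map_add, ha, hb, add_mul]

variable (k h) in
theorem ofTensor_bijective : Function.Bijective (ofTensor k h) := by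
  refine ⟨Function.LeftInverse.injective (g := fun b => rep k h b (1 ⊗ₜ 1)) rep_ofTensor,
    fun b => ⟨rep k h b (1 ⊗ₜ 1), ?_⟩⟩
  rw [ofTensor_rep, ofTensor_tmul, map_one, map_one, mul_one, mul_one]

variable (k h) in
/-- The basis of standard monomials of `B(h)`, indexed by pairs of pairs. -/
noncomputable def basis : Module.Basis ((ℕ × ℕ) × (ℕ × ℕ)) k (Bh k h) :=
  ((Aq.basis k).tensorProduct (Aq.basis k)).map
    (LinearEquiv.ofBijective (ofTensor k h) (ofTensor_bijective k h))

theorem inclX_basis (n : ℕ × ℕ) : inclX k h (Aq.basis k n) = bX₁ k h ^ n.1 * bX₂ k h ^ n.2 := by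
  simp [inclX]

theorem inclY_basis (n : ℕ × ℕ) : inclY k h (Aq.basis k n) = bY₁ k h ^ n.1 * bY₂ k h ^ n.2 := by
  simp [inclY]

variable (k h) in
/-- The basis of standard monomials of `B(h)`. -/
noncomputable def monomialBasis : Module.Basis (ℕ × ℕ × ℕ × ℕ) k (Bh k h) :=
  (basis k h).reindex (Equiv.prodAssoc _ _ _)

theorem coe_monomialBasis : ⇑(monomialBasis k h) = fun n =>
    bX₁ k h ^ n.1 * bX₂ k h ^ n.2.1 * bY₁ k h ^ n.2.2.1 * bY₂ k h ^ n.2.2.2 := by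
  ext n
  simp only [monomialBasis, basis, Module.Basis.reindex_apply, Module.Basis.map_apply,
    Module.Basis.tensorProduct_apply, LinearEquiv.ofBijective_apply, ofTensor_tmul,
    inclX_basis, inclY_basis, Equiv.prodAssoc_symm_apply, mul_assoc]

variable (k h) in
theorem inclX_injective : Function.Injective (inclX k h) := by
  intro a b hab
  have : rep k h (inclX k h a) (1 ⊗ₜ 1) = rep k h (inclX k h b) (1 ⊗ₜ 1) := by rw [hab]
  rw [rep_inclX, rep_inclX, opX_tmul, opX_tmul, mul_one, mul_one] at this
  have : Nontrivial (Aq k) := (Aq.basis k).repr.toEquiv.nontrivial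
  exact Algebra.TensorProduct.includeLeft_injective (S := k)
    (FaithfulSMul.algebraMap_injective k (Aq k)) ‹_›

variable (k h) in
theorem range_inclX : (inclX k h).range = Algebra.adjoin k {bX₁ k h, bX₂ k h} := by
  apply le_antisymm
  · rintro _ ⟨a, rfl⟩
    change inclX k h a ∈ _
    induction a using Aq.induction with
    | scalar c => rw [AlgHom.commutes]; exact Subalgebra.algebraMap_mem _ c
    | x₁ => exact Algebra.subset_adjoin (by simp [inclX])
    | x₂ => exact Algebra.subset_adjoin (by simp [inclX])
    | mul a b ha hb => rw [map_mul]; exact mul_mem ha hb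
    | add a b ha hb => rw [map_add]; exact add_mem ha hb
  · rw [Algebra.adjoin_le_iff]
    rintro _ (rfl | rfl)
    · exact ⟨aX₁ k, by simp [inclX]⟩
    · exact ⟨aX₂ k, by simp [inclX]⟩

variable (k h) in
/-- The isomorphism of `A` with the subalgebra of `B(h)` generated by `x₁, x₂`. -/
noncomputable def equivAdjoin : Aq k ≃ₐ[k] Algebra.adjoin k {bX₁ k h, bX₂ k h} :=
  (AlgEquiv.ofInjective (inclX k h) (inclX_injective k h)).trans
    (Subalgebra.equivOfEq _ _ (range_inclX k h))

@[simp]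
theorem coe_equivAdjoin (a : Aq k) : (equivAdjoin k h a : Bh k h) = inclX k h a := rfl

theorem ofTensor_basis_repr_symm (g : ℕ × ℕ →₀ Aq k) :
    ofTensor k h ((Algebra.TensorProduct.basis (Aq k) (Aq.basis k)).repr.symm g) =
      g.sum fun n a => inclX k h a * (bY₁ k h ^ n.1 * bY₂ k h ^ n.2) := by
  rw [Module.Basis.repr_symm_apply, Finsupp.linearCombination_apply, map_finsuppSum]
  refine Finsupp.sum_congr fun n _ => ?_
  rw [Algebra.TensorProduct.basis_apply, TensorProduct.smul_tmul', ofTensor_tmul, smul_eq_mul,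
    mul_one, inclY_basis]

theorem existsUnique_left_expansion (b : Bh k h) :
    ∃! f : ℕ × ℕ →₀ Algebra.adjoin k ({bX₁ k h, bX₂ k h} : Set (Bh k h)),
      b = f.sum fun n a => (a : Bh k h) * (bY₁ k h ^ n.1 * bY₂ k h ^ n.2) := by
  let E : (ℕ × ℕ →₀ Aq k) ≃
      (ℕ × ℕ →₀ Algebra.adjoin k ({bX₁ k h, bX₂ k h} : Set (Bh k h))) :=
    Finsupp.mapRange.equiv (equivAdjoin k h).toEquiv (map_zero (equivAdjoin k h))
  have hE : ∀ g, ((E g).sum fun n a => (a : Bh k h) * (bY₁ k h ^ n.1 * bY₂ k h ^ n.2)) =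
      ofTensor k h ((Algebra.TensorProduct.basis (Aq k) (Aq.basis k)).repr.symm g) := by
    intro g
    rw [ofTensor_basis_repr_symm]
    exact Finsupp.sum_mapRange_index (hf := map_zero (equivAdjoin k h)) fun n => by simp
  refine (E.bijective.existsUnique_iff).2 ?_
  simp only [hE, eq_comm (a := b)]
  exact ((ofTensor_bijective k h).comp
    (Algebra.TensorProduct.basis (Aq k) (Aq.basis k)).repr.symm.bijective).existsUnique b

end Bh

end MonomialBasis

/-- The monomials `x₁^a x₂^b y₁^c y₂^d` form a `k`-vector space basis of `B(h)`;
in particular `B(h)` is a free left module over its subalgebra generated by `x₁, x₂`,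
with basis the monomials `y₁^c y₂^d`, and that subalgebra is isomorphic to
`k⟨x₁,x₂⟩/(x₁x₂ + x₂x₁)`. -/
theorem Bh_monomial_basis (k : Type*) [Field k] (h : k) (hh : h ≠ 0) :
    (LinearIndependent k (fun n : ℕ × ℕ × ℕ × ℕ =>
        bX₁ k h ^ n.1 * bX₂ k h ^ n.2.1 * bY₁ k h ^ n.2.2.1 * bY₂ k h ^ n.2.2.2) ∧
      ⊤ ≤ Submodule.span k (Set.range fun n : ℕ × ℕ × ℕ × ℕ =>
        bX₁ k h ^ n.1 * bX₂ k h ^ n.2.1 * bY₁ k h ^ n.2.2.1 * bY₂ k h ^ n.2.2.2)) ∧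
    (∀ b : Bh k h,
      ∃! f : ℕ × ℕ →₀ Algebra.adjoin k ({bX₁ k h, bX₂ k h} : Set (Bh k h)),
        b = f.sum fun n a => (a : Bh k h) * (bY₁ k h ^ n.1 * bY₂ k h ^ n.2)) ∧
    (∃ e : Aq k ≃ₐ[k] Algebra.adjoin k ({bX₁ k h, bX₂ k h} : Set (Bh k h)),
      (e (aX₁ k) : Bh k h) = bX₁ k h ∧ (e (aX₂ k) : Bh k h) = bX₂ k h) := by
  refine ⟨⟨?_, ?_⟩, Bh.existsUnique_left_expansion, Bh.equivAdjoin k h, ?_, ?_⟩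
  · rw [← Bh.coe_monomialBasis]
    exact (Bh.monomialBasis k h).linearIndependent
  · rw [← Bh.coe_monomialBasis]
    exact (Bh.monomialBasis k h).span_eq.ge
  · simp [Bh.inclX]
  · simp [Bh.inclX]
end

section
/- Each of the four elements z ∈ {x₁x₂, x₁² + x₂², y₁y₂, y₁² + y₂²} of B(h) is a normal element, i.e. z·B(h) = B(h)·z as subsets of B(h); explicitly, y₁(x₁x₂) = −h²(x₁x₂)y₁, y₂(x₁x₂) = −h²(x₁x₂)y₂, y₁(x₁² + x₂²) = h²(x₁² + x₂²)y₁ and y₂(x₁² + x₂²) = h²(x₁² + x₂²)y₂. Moreover, B(h) is left noetherian and right noetherian. -/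
section LeadingTerms

variable {k A ι : Type*} [Field k] [Ring A] [Algebra k A] [LinearOrder ι]

/-- The indices `i` such that `I` contains an element `m i + (terms below i)`. -/
def leadingIndices (k : Type*) {A ι : Type*} [Field k] [Ring A] [Algebra k A] [LinearOrder ι]
    (m : ι → A) (I : Ideal A) : Set ι :=
  {i | ∃ x ∈ I, x - m i ∈ Submodule.span k (m '' Set.Iio i)}

lemma leadingIndices_mono (m : ι → A) : Monotone (leadingIndices k m) :=
  fun _ _ hIJ _ ⟨x, hx, hxi⟩ => ⟨x, hIJ hx, hxi⟩

lemma eq_zero_or_mem_span_image_Iic {m : ι → A} {s : Set ι} {x : A}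
    (hx : x ∈ Submodule.span k (m '' s)) :
    x = 0 ∨ ∃ i ∈ s, x ∈ Submodule.span k (m '' Set.Iic i) := by
  induction hx using Submodule.span_induction with
  | mem x hx =>
    obtain ⟨i, hi, rfl⟩ := hx
    exact Or.inr ⟨i, hi, Submodule.subset_span ⟨i, le_rfl, rfl⟩⟩
  | zero => exact Or.inl rfl
  | add x y _ _ hx hy =>
    obtain rfl | ⟨i, hi, hxi⟩ := hx
    · simpa using hy
    obtain rfl | ⟨j, hj, hyj⟩ := hy
    · simpa using Or.inr ⟨i, hi, hxi⟩
    have key : ∀ l, i ≤ l → j ≤ l → x + y ∈ Submodule.span k (m '' Set.Iic l) := fun l hil hjl =>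
      add_mem (Submodule.span_mono (Set.image_mono (Set.Iic_subset_Iic.2 hil)) hxi)
        (Submodule.span_mono (Set.image_mono (Set.Iic_subset_Iic.2 hjl)) hyj)
    obtain hij | hij := le_total i j
    · exact Or.inr ⟨j, hj, key j hij le_rfl⟩
    · exact Or.inr ⟨i, hi, key i le_rfl hij⟩
  | smul c x _ hx =>
    obtain rfl | ⟨i, hi, hxi⟩ := hx
    · simp
    · exact Or.inr ⟨i, hi, Submodule.smul_mem _ c hxi⟩

lemma le_of_leadingIndices_subset [WellFoundedLT ι] {m : ι → A}
    (hm : Submodule.span k (Set.range m) = ⊤) {I J : Ideal A} (hIJ : I ≤ J)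
    (h : leadingIndices k m J ⊆ leadingIndices k m I) : J ≤ I := by
  have key : ∀ i, ∀ x ∈ J, x ∈ Submodule.span k (m '' Set.Iic i) → x ∈ I := by
    intro i
    induction i using WellFoundedLT.induction with
    | ind i ih =>
      have below : ∀ x ∈ J, x ∈ Submodule.span k (m '' Set.Iio i) → x ∈ I := by
        intro x hxJ hx
        obtain rfl | ⟨j, hj, hxj⟩ := eq_zero_or_mem_span_image_Iic hx
        · exact I.zero_mem
        · exact ih j hj x hxJ hxj
      intro x hxJ hx
      rw [← Set.Iio_insert, Set.image_insert_eq, Submodule.mem_span_insert] at hx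
      obtain ⟨c, r, hr, rfl⟩ := hx
      obtain rfl | hc := eq_or_ne c 0
      · rw [zero_smul, zero_add] at hxJ ⊢
        exact below r hxJ hr
      · obtain ⟨z, hzI, hz⟩ : i ∈ leadingIndices k m I := by
          refine h ⟨c⁻¹ • (c • m i + r), Submodule.smul_of_tower_mem J _ hxJ, ?_⟩
          rw [smul_add, inv_smul_smul₀ hc, add_sub_cancel_left]
          exact Submodule.smul_mem _ _ hr
        have hcz : c • z ∈ I := Submodule.smul_of_tower_mem I _ hzI
        have hd : c • m i + r - c • z ∈ I := by
          refine below _ (J.sub_mem hxJ (hIJ hcz)) ?_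
          have : c • m i + r - c • z = r - c • (z - m i) := by module
          rw [this]
          exact sub_mem hr (Submodule.smul_mem _ _ hz)
        simpa using I.add_mem hd hcz
  intro x hx
  have hx' : x ∈ Submodule.span k (m '' Set.univ) := by simp [hm]
  obtain rfl | ⟨i, -, hi⟩ := eq_zero_or_mem_span_image_Iic hx'
  · exact I.zero_mem
  · exact key i x hx hi

theorem isNoetherianRing_of_leadingIndices [WellFoundedLT ι] {m : ι → A}
    (hm : Submodule.span k (Set.range m) = ⊤) {r : ι → ι → Prop} (hr : WellQuasiOrdered r)
    (hmul : ∀ i j, r i j → ∃ a : A, a * m i = m j ∧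
      ∀ l < i, a * m l ∈ Submodule.span k (m '' Set.Iio j)) :
    IsNoetherianRing A := by
  have up : ∀ (I : Ideal A) i j, r i j → i ∈ leadingIndices k m I → j ∈ leadingIndices k m I := by
    rintro I i j hij ⟨x, hxI, hx⟩
    obtain ⟨a, ha, hlt⟩ := hmul i j hij
    refine ⟨a * x, I.mul_mem_left a hxI, ?_⟩
    rw [← ha, ← mul_sub]
    have : Submodule.span k (m '' Set.Iio i) ≤
        (Submodule.span k (m '' Set.Iio j)).comap (LinearMap.mulLeft k a) := by
      rw [Submodule.span_le]
      rintro _ ⟨l, hl, rfl⟩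
      exact hlt l hl
    exact this hx
  rw [isNoetherianRing_iff, isNoetherian_iff', wellFoundedGT_iff_monotone_chain_condition]
  intro f
  by_contra! hf
  have step : ∀ n, ∃ N, n ≤ N ∧ ∃ i, i ∈ leadingIndices k m (f N) ∧
      i ∉ leadingIndices k m (f n) := by
    intro n
    obtain ⟨N, hN, hne⟩ := hf n
    refine ⟨N, hN, ?_⟩
    by_contra! hcon
    exact hne (le_antisymm (f.mono hN) (le_of_leadingIndices_subset hm (f.mono hN) hcon))
  choose next hnext lead hlead hnlead using step
  have hs : ∀ i j, i < j → next (next^[i] 0) ≤ next^[j] 0 := by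
    intro i j hij
    rw [← Function.iterate_succ_apply' next]
    exact monotone_nat_of_le_succ (f := fun n => next^[n] 0)
      (fun n => by simpa only [Function.iterate_succ_apply'] using hnext _) hij
  obtain ⟨i, j, hij, h⟩ := hr fun n => lead (next^[n] 0)
  exact hnlead _ (up _ _ _ h (leadingIndices_mono m (f.mono (hs i j hij)) (hlead _)))

/-- An algebra that is finitely generated as a left module over a quantum affine space
(spanned by monomials `T α` which multiply up to nonzero scalars) is left noetherian. -/
theorem isNoetherianRing_of_monomials {n : ℕ} {ε : Type*} [Finite ε]
    (T : (Fin n → ℕ) → A) (w : ε → A)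
    (hT : ∀ α β, ∃ c : kˣ, T α * T β = c • T (α + β))
    (hspan : Submodule.span k (Set.range fun p : (Fin n → ℕ) × ε => T p.1 * w p.2) = ⊤) :
    IsNoetherianRing A := by
  obtain ⟨N, ⟨e⟩⟩ := Finite.exists_equiv_fin ε
  let m : Lex (Fin n → ℕ) ×ₗ Fin N → A :=
    fun p => T (ofLex (ofLex p).1) * w (e.symm (ofLex p).2)
  have hm : Submodule.span k (Set.range m) = ⊤ := by
    rw [← hspan]
    congr 1
    ext x
    constructor
    · rintro ⟨p, rfl⟩
      exact ⟨(ofLex (ofLex p).1, e.symm (ofLex p).2), rfl⟩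
    · rintro ⟨⟨α, i⟩, rfl⟩
      exact ⟨toLex (toLex α, e i), by simp [m]⟩
  have hr : WellQuasiOrdered fun p q : (Fin n → ℕ) × Fin N => p.1 ≤ q.1 ∧ p.2 = q.2 :=
    (WellQuasiOrdered.pi fun _ => wellQuasiOrdered_le).prod (Finite.wellQuasiOrdered _)
  refine isNoetherianRing_of_leadingIndices (k := k) hm
    (r := fun p q => ofLex (ofLex p).1 ≤ ofLex (ofLex q).1 ∧ (ofLex p).2 = (ofLex q).2)
    (fun f => hr fun n => (ofLex (ofLex (f n)).1, (ofLex (f n)).2)) ?_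
  rintro p q ⟨hle, heq⟩
  obtain ⟨δ, hδ⟩ := exists_add_of_le hle
  rw [add_comm] at hδ
  obtain ⟨c, hc⟩ := hT δ (ofLex (ofLex p).1)
  refine ⟨c⁻¹ • T δ, ?_, fun l hl => ?_⟩
  · simp only [m]
    rw [← mul_assoc, smul_mul_assoc, hc, inv_smul_smul, hδ, heq]
  · obtain ⟨d, hd⟩ := hT δ (ofLex (ofLex l).1)
    simp only [m]
    rw [← mul_assoc, smul_mul_assoc, hd, smul_mul_assoc, smul_mul_assoc]
    refine Submodule.smul_of_tower_mem _ _ (Submodule.smul_of_tower_mem _ _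
      (Submodule.subset_span ⟨toLex (toLex δ + (ofLex l).1, (ofLex l).2), ?_, rfl⟩))
    have hq : (ofLex q).1 = toLex δ + (ofLex p).1 := hδ
    rw [Set.mem_Iio, Prod.Lex.lt_iff]
    rw [Prod.Lex.lt_iff] at hl
    obtain hl | ⟨h1, h2⟩ := hl
    · left
      rw [hq]
      exact add_lt_add_right hl _
    · right
      exact ⟨by rw [hq, ← h1]; rfl, by rw [← heq]; exact h2⟩

end LeadingTerms

section Skew

variable (k : Type*) {A : Type*} [Field k] [Ring A] [Algebra k A]

/-- Equality up to a nonzero scalar, as a multiplicative congruence. -/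
def scalarCon (A : Type*) [Ring A] [Algebra k A] : Con A where
  r a b := ∃ u : kˣ, a = u • b
  iseqv :=
    { refl := fun a => ⟨1, (one_smul _ a).symm⟩
      symm := fun ⟨u, hu⟩ => ⟨u⁻¹, by rw [hu, inv_smul_smul]⟩
      trans := fun ⟨u, hu⟩ ⟨v, hv⟩ => ⟨u * v, by rw [hu, hv, mul_smul]⟩ }
  mul' := fun ⟨u, hu⟩ ⟨v, hv⟩ => ⟨u * v, by rw [hu, hv, smul_mul_smul_comm]⟩

/-- Two elements skew commute if they commute up to a nonzero scalar. -/
def SkewCommute (a b : A) : Prop := Commute (a : (scalarCon k A).Quotient) b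

variable {k}

lemma skewCommute_iff {a b : A} : SkewCommute k a b ↔ ∃ u : kˣ, a * b = u • (b * a) :=
  (scalarCon k A).eq

lemma SkewCommute.of_eq_smul {a b : A} {c : k} (hc : c ≠ 0) (hab : a * b = c • (b * a)) :
    SkewCommute k a b :=
  skewCommute_iff.2 ⟨Units.mk0 c hc, hab⟩

lemma SkewCommute.of_commute {a b : A} (hab : a * b = b * a) : SkewCommute k a b :=
  .of_eq_smul one_ne_zero (by rw [hab, one_smul])

lemma SkewCommute.of_eq_neg {a b : A} (hab : a * b = -(b * a)) : SkewCommute k a b :=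
  .of_eq_smul (neg_ne_zero.2 one_ne_zero) (by rw [hab, neg_smul, one_smul])

lemma SkewCommute.symm {a b : A} (hab : SkewCommute k a b) : SkewCommute k b a :=
  Commute.symm hab

lemma SkewCommute.pow_right {a b : A} (hab : SkewCommute k a b) (n : ℕ) :
    SkewCommute k a (b ^ n) :=
  Commute.pow_right hab n

lemma SkewCommute.pow_pow {a b : A} (hab : SkewCommute k a b) (m n : ℕ) :
    SkewCommute k (a ^ m) (b ^ n) :=
  Commute.pow_pow hab m n

lemma SkewCommute.mul_right {a b c : A} (hab : SkewCommute k a b) (hac : SkewCommute k a c) :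
    SkewCommute k a (b * c) :=
  Commute.mul_right hab hac

lemma exists_mul_eq_mul_of_skewCommute {s : Set A} (hs : Algebra.adjoin k s = ⊤) {z : A}
    (hz : ∀ g ∈ s, SkewCommute k z g) :
    {w : A | ∃ b, w = z * b} = {w : A | ∃ b, w = b * z} := by
  have hl : ∀ b, ∃ b', z * b = b' * z := by
    intro b
    have hb : b ∈ Algebra.adjoin k s := hs ▸ Algebra.mem_top
    induction hb using Algebra.adjoin_induction with
    | mem g hg =>
      obtain ⟨u, hu⟩ := skewCommute_iff.1 (hz g hg)
      exact ⟨u • g, by rw [hu, smul_mul_assoc]⟩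
    | algebraMap r => exact ⟨_, (Algebra.commutes r z).symm⟩
    | add x y _ _ hx hy =>
      obtain ⟨x', hx⟩ := hx
      obtain ⟨y', hy⟩ := hy
      exact ⟨x' + y', by rw [mul_add, hx, hy, add_mul]⟩
    | mul x y _ _ hx hy =>
      obtain ⟨x', hx⟩ := hx
      obtain ⟨y', hy⟩ := hy
      exact ⟨x' * y', by rw [← mul_assoc, hx, mul_assoc, hy, mul_assoc]⟩
  have hr : ∀ b, ∃ b', b * z = z * b' := by
    intro b
    have hb : b ∈ Algebra.adjoin k s := hs ▸ Algebra.mem_top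
    induction hb using Algebra.adjoin_induction with
    | mem g hg =>
      obtain ⟨u, hu⟩ := skewCommute_iff.1 (hz g hg).symm
      exact ⟨u • g, by rw [hu, mul_smul_comm]⟩
    | algebraMap r => exact ⟨_, Algebra.commutes r z⟩
    | add x y _ _ hx hy =>
      obtain ⟨x', hx⟩ := hx
      obtain ⟨y', hy⟩ := hy
      exact ⟨x' + y', by rw [add_mul, hx, hy, mul_add]⟩
    | mul x y _ _ hx hy =>
      obtain ⟨x', hx⟩ := hx
      obtain ⟨y', hy⟩ := hy
      exact ⟨x' * y', by rw [mul_assoc, hy, ← mul_assoc, hx, mul_assoc]⟩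
  ext w
  constructor
  · rintro ⟨b, rfl⟩
    exact hl b
  · rintro ⟨b, rfl⟩
    exact hr b

lemma Algebra.toSubmodule_adjoin_le {s : Set A} {W : Submodule k A} (h1 : 1 ∈ W)
    (hs : ∀ g ∈ s, ∀ v ∈ W, g * v ∈ W) : Subalgebra.toSubmodule (Algebra.adjoin k s) ≤ W := by
  intro a ha
  have key : ∀ v ∈ W, a * v ∈ W := by
    induction ha using Algebra.adjoin_induction with
    | mem g hg => exact hs g hg
    | algebraMap r =>
      intro v hv
      rw [← Algebra.smul_def]
      exact W.smul_mem r hv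
    | add x y _ _ hx hy =>
      intro v hv
      rw [add_mul]
      exact add_mem (hx v hv) (hy v hv)
    | mul x y _ _ hx hy =>
      intro v hv
      rw [mul_assoc]
      exact hx _ (hy v hv)
  simpa using key 1 h1

end Skew

/-- The elements `x₁, x₂, y₁, y₂` generate `A` and satisfy the defining relations of `B(h)`. -/
structure BhGenerators {k A : Type*} [Field k] [Ring A] [Algebra k A] (h : k)
    (x₁ x₂ y₁ y₂ : A) : Prop where
  x₂_mul_x₁ : x₂ * x₁ = -(x₁ * x₂)
  y₂_mul_y₁ : y₂ * y₁ = -(y₁ * y₂)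
  y₁_mul_x₁ : y₁ * x₁ = h • (x₁ * y₁ + x₂ * y₁ + x₁ * y₂)
  y₁_mul_x₂ : y₁ * x₂ = h • (x₁ * y₂)
  y₂_mul_x₁ : y₂ * x₁ = h • (x₂ * y₁)
  y₂_mul_x₂ : y₂ * x₂ = h • (-(x₂ * y₁) - x₁ * y₂ + x₂ * y₂)
  adjoin_eq_top : Algebra.adjoin k {x₁, x₂, y₁, y₂} = ⊤

namespace BhGenerators

variable {k A : Type*} [Field k] [Ring A] [Algebra k A] {h : k} {x₁ x₂ y₁ y₂ : A}

open MulOpposite in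
lemma op (H : BhGenerators h x₁ x₂ y₁ y₂) :
    BhGenerators h (op y₁) (op y₂) (op x₁) (op x₂) where
  x₂_mul_x₁ := by simp [← op_mul, ← op_neg, H.y₂_mul_y₁]
  y₂_mul_y₁ := by simp [← op_mul, ← op_neg, H.x₂_mul_x₁]
  y₁_mul_x₁ := by
    simp only [← op_mul, ← op_add, ← op_smul, H.y₁_mul_x₁]
    congr 2
    abel
  y₁_mul_x₂ := by simp only [← op_mul, ← op_smul, H.y₂_mul_x₁]
  y₂_mul_x₁ := by simp only [← op_mul, ← op_smul, H.y₁_mul_x₂]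
  y₂_mul_x₂ := by
    simp only [← op_mul, ← op_add, ← op_sub, ← op_neg, ← op_smul, H.y₂_mul_x₂]
    congr 2
    abel
  adjoin_eq_top := by
    have := congrArg Subalgebra.op H.adjoin_eq_top
    rw [Subalgebra.op_adjoin, Subalgebra.op_top] at this
    rw [← this]
    congr 1
    ext z
    simp only [Set.mem_insert_iff, Set.mem_singleton_iff, Set.mem_preimage, ← unop_inj, unop_op]
    tauto

lemma y₁_mul_x₁_mul_x₂ (H : BhGenerators h x₁ x₂ y₁ y₂) :
    y₁ * (x₁ * x₂) = -(h ^ 2 • (x₁ * x₂ * y₁)) := by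
  simp only [← mul_assoc, H.y₁_mul_x₁]
  simp only [add_mul, mul_assoc, smul_mul_assoc, H.y₁_mul_x₂, H.y₂_mul_x₂]
  simp only [mul_add, mul_sub, mul_neg, mul_smul_comm, ← mul_assoc, H.x₂_mul_x₁, neg_mul]
  module

lemma y₂_mul_x₁_mul_x₂ (H : BhGenerators h x₁ x₂ y₁ y₂) :
    y₂ * (x₁ * x₂) = -(h ^ 2 • (x₁ * x₂ * y₂)) := by
  simp only [← mul_assoc, H.y₂_mul_x₁]
  simp only [mul_assoc, smul_mul_assoc, H.y₁_mul_x₂]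
  simp only [mul_smul_comm, ← mul_assoc, H.x₂_mul_x₁, neg_mul]
  module

lemma y₁_mul_sq_add_sq (H : BhGenerators h x₁ x₂ y₁ y₂) :
    y₁ * (x₁ ^ 2 + x₂ ^ 2) = h ^ 2 • ((x₁ ^ 2 + x₂ ^ 2) * y₁) := by
  simp only [pow_two x₁, pow_two x₂, mul_add, ← mul_assoc, H.y₁_mul_x₁, H.y₁_mul_x₂]
  simp only [add_mul, mul_assoc, smul_mul_assoc, H.y₁_mul_x₁, H.y₂_mul_x₁, H.y₂_mul_x₂]
  simp only [mul_add, mul_sub, mul_neg, mul_smul_comm, ← mul_assoc, H.x₂_mul_x₁, neg_mul]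
  module

lemma y₂_mul_sq_add_sq (H : BhGenerators h x₁ x₂ y₁ y₂) :
    y₂ * (x₁ ^ 2 + x₂ ^ 2) = h ^ 2 • ((x₁ ^ 2 + x₂ ^ 2) * y₂) := by
  simp only [pow_two x₁, pow_two x₂, mul_add, ← mul_assoc, H.y₂_mul_x₁, H.y₂_mul_x₂]
  simp only [add_mul, sub_mul, neg_mul, mul_assoc, smul_mul_assoc, H.y₁_mul_x₁, H.y₁_mul_x₂,
    H.y₂_mul_x₂]
  simp only [mul_add, mul_sub, mul_neg, mul_smul_comm, ← mul_assoc, H.x₂_mul_x₁, neg_mul]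
  module

open MulOpposite in
lemma y₁_mul_y₂_mul_x₁ (H : BhGenerators h x₁ x₂ y₁ y₂) :
    y₁ * y₂ * x₁ = -(h ^ 2 • (x₁ * (y₁ * y₂))) := by
  have := congrArg unop H.op.y₁_mul_x₁_mul_x₂
  simpa [H.y₂_mul_y₁, neg_eq_iff_eq_neg] using this

open MulOpposite in
lemma y₁_mul_y₂_mul_x₂ (H : BhGenerators h x₁ x₂ y₁ y₂) :
    y₁ * y₂ * x₂ = -(h ^ 2 • (x₂ * (y₁ * y₂))) := by
  have := congrArg unop H.op.y₂_mul_x₁_mul_x₂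
  simpa [H.y₂_mul_y₁, neg_eq_iff_eq_neg] using this

open MulOpposite in
lemma sq_add_sq_mul_x₁ (H : BhGenerators h x₁ x₂ y₁ y₂) :
    (y₁ ^ 2 + y₂ ^ 2) * x₁ = h ^ 2 • (x₁ * (y₁ ^ 2 + y₂ ^ 2)) := by
  simpa using congrArg unop H.op.y₁_mul_sq_add_sq

open MulOpposite in
lemma sq_add_sq_mul_x₂ (H : BhGenerators h x₁ x₂ y₁ y₂) :
    (y₁ ^ 2 + y₂ ^ 2) * x₂ = h ^ 2 • (x₂ * (y₁ ^ 2 + y₂ ^ 2)) := by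
  simpa using congrArg unop H.op.y₂_mul_sq_add_sq

end BhGenerators

section SkewPair

variable {k A : Type*} [Field k] [Ring A] [Algebra k A] {x₁ x₂ : A}

lemma commute_sq_of_mul_eq_neg (hx : x₂ * x₁ = -(x₁ * x₂)) : x₁ * x₂ ^ 2 = x₂ ^ 2 * x₁ := by
  simp only [pow_two, mul_assoc, hx, mul_neg]
  simp only [← mul_assoc, hx, neg_mul, neg_neg]

lemma commute_sq_of_mul_eq_neg' (hx : x₂ * x₁ = -(x₁ * x₂)) : x₂ * x₁ ^ 2 = x₁ ^ 2 * x₂ := by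
  simp only [pow_two, ← mul_assoc, hx, neg_mul]
  simp only [mul_assoc, hx, mul_neg, neg_neg]

lemma commute_left_sq_add_sq (hx : x₂ * x₁ = -(x₁ * x₂)) :
    x₁ * (x₁ ^ 2 + x₂ ^ 2) = (x₁ ^ 2 + x₂ ^ 2) * x₁ := by
  rw [mul_add, add_mul, commute_sq_of_mul_eq_neg hx, (Commute.self_pow x₁ 2).eq]

lemma commute_right_sq_add_sq (hx : x₂ * x₁ = -(x₁ * x₂)) :
    x₂ * (x₁ ^ 2 + x₂ ^ 2) = (x₁ ^ 2 + x₂ ^ 2) * x₂ := by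
  rw [mul_add, add_mul, commute_sq_of_mul_eq_neg' hx, (Commute.self_pow x₂ 2).eq]

lemma left_mul_prod_eq_neg (hx : x₂ * x₁ = -(x₁ * x₂)) :
    x₁ * (x₁ * x₂) = -(x₁ * x₂ * x₁) := by
  rw [mul_assoc x₁ x₂ x₁, hx, mul_neg, neg_neg]

lemma right_mul_prod_eq_neg (hx : x₂ * x₁ = -(x₁ * x₂)) :
    x₂ * (x₁ * x₂) = -(x₁ * x₂ * x₂) := by
  rw [← mul_assoc, hx, neg_mul]

variable (k) in
lemma adjoin_pair_le_span_monomials (hx : x₂ * x₁ = -(x₁ * x₂)) :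
    Subalgebra.toSubmodule (Algebra.adjoin k {x₁, x₂}) ≤
      Submodule.span k (Set.range fun p : ℕ × ℕ => x₁ ^ p.1 * x₂ ^ p.2) := by
  refine Algebra.toSubmodule_adjoin_le (Submodule.subset_span ⟨(0, 0), by simp⟩) ?_
  intro g hg
  change Submodule.span k _ ≤ (Submodule.span k _).comap (LinearMap.mulLeft k g)
  rw [Submodule.span_le]
  rintro _ ⟨⟨i, j⟩, rfl⟩
  obtain rfl | rfl := hg
  · exact Submodule.subset_span ⟨(i + 1, j), by simp [pow_succ', mul_assoc]⟩
  · obtain ⟨u, hu⟩ := skewCommute_iff.1 ((SkewCommute.of_eq_neg (k := k) hx).pow_right i)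
    simp only [SetLike.mem_coe, Submodule.mem_comap, LinearMap.mulLeft_apply]
    rw [← mul_assoc, hu, smul_mul_assoc, mul_assoc, ← pow_succ']
    exact Submodule.smul_of_tower_mem _ _ (Submodule.subset_span ⟨(i, j + 1), rfl⟩)

variable (k) in
lemma adjoin_pair_le_span_central_monomials {y₁ y₂ : A} (hy : y₂ * y₁ = -(y₁ * y₂)) :
    Subalgebra.toSubmodule (Algebra.adjoin k {y₁, y₂}) ≤
      Submodule.span k (Set.range fun p : (ℕ × ℕ) × Fin 5 =>
        (y₁ * y₂) ^ p.1.1 * (y₁ ^ 2 + y₂ ^ 2) ^ p.1.2 *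
          ![1, y₁, y₁ ^ 2, y₁ ^ 3, y₂] p.2) := by
  set c := y₁ * y₂ with hc
  set d := y₁ ^ 2 + y₂ ^ 2 with hd
  set w : Fin 5 → A := ![1, y₁, y₁ ^ 2, y₁ ^ 3, y₂] with hw
  set W := Submodule.span k (Set.range fun p : (ℕ × ℕ) × Fin 5 => c ^ p.1.1 * d ^ p.1.2 * w p.2)
    with hW
  have hcd : d * c = c * d := by
    have h1 := commute_left_sq_add_sq hy
    have h2 := commute_right_sq_add_sq hy
    rw [hc, ← mul_assoc, ← h1, mul_assoc, ← h2, mul_assoc]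
  have hcW : ∀ v ∈ W, c * v ∈ W := by
    change W ≤ W.comap (LinearMap.mulLeft k c)
    rw [hW, Submodule.span_le]
    rintro _ ⟨⟨⟨i, j⟩, e⟩, rfl⟩
    exact Submodule.subset_span ⟨((i + 1, j), e), by simp [pow_succ', mul_assoc]⟩
  have hdW : ∀ v ∈ W, d * v ∈ W := by
    change W ≤ W.comap (LinearMap.mulLeft k d)
    rw [hW, Submodule.span_le]
    rintro _ ⟨⟨⟨i, j⟩, e⟩, rfl⟩
    refine Submodule.subset_span ⟨((i, j + 1), e), ?_⟩
    simp only [LinearMap.mulLeft_apply, pow_succ', ← mul_assoc]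
    rw [((show Commute d c from hcd).pow_right i).eq]
  have hcdW : ∀ i j, ∀ v ∈ W, c ^ i * d ^ j * v ∈ W := by
    intro i j v hv
    induction i with
    | zero =>
      rw [pow_zero, one_mul]
      induction j with
      | zero => simpa using hv
      | succ j ih =>
        rw [pow_succ', mul_assoc]
        exact hdW _ ih
    | succ i ih =>
      rw [pow_succ', mul_assoc, mul_assoc, ← mul_assoc (c ^ i)]
      exact hcW _ ih
  have hwW : ∀ e, w e ∈ W := fun e => Submodule.subset_span ⟨((0, 0), e), by simp⟩
  have h0 : (1 : A) ∈ W := hwW 0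
  have h1 : y₁ ∈ W := hwW 1
  have h2 : y₁ ^ 2 ∈ W := hwW 2
  have h3 : y₁ ^ 3 ∈ W := hwW 3
  have h4 : y₂ ∈ W := hwW 4
  have e2 : y₂ * y₁ ^ 2 = -(c * y₁) := by
    rw [pow_two, ← mul_assoc, hy, neg_mul]
  have e3 : y₂ * y₁ ^ 3 = -(c * y₁ ^ 2) := by
    rw [pow_succ' y₁ 2, ← mul_assoc, hy, neg_mul]
  have e4 : y₁ ^ 4 = d * y₁ ^ 2 + c * c := by
    have : c * c = -(y₂ ^ 2 * y₁ ^ 2) := by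
      have hyc : y₂ * c = -(c * y₂) := right_mul_prod_eq_neg hy
      rw [pow_two y₂, mul_assoc y₂ y₂, e2, mul_neg, neg_neg, ← mul_assoc y₂ c, hyc, neg_mul,
        mul_assoc c y₂, hy, mul_neg, neg_neg]
    rw [this, hd, add_mul]
    simp [← pow_add]
  have g1 : ∀ e, y₁ * w e ∈ W := by
    intro e
    fin_cases e
    · simpa [hw] using h1
    · simpa [hw, ← pow_two] using h2
    · simpa [hw, ← pow_succ'] using h3
    · have : y₁ * w 3 = d * y₁ ^ 2 + c * c := by
        rw [← e4]
        simp [hw, ← pow_succ']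
      change y₁ * w 3 ∈ W
      rw [this]
      exact add_mem (hdW _ h2) (hcW _ (by simpa using hcW _ h0))
    · simpa [hw] using hcW _ h0
  have g2 : ∀ e, y₂ * w e ∈ W := by
    intro e
    fin_cases e
    · simpa [hw] using h4
    · simpa [hw, hy] using hcW _ h0
    · simpa [hw, e2] using hcW _ h1
    · simpa [hw, e3] using hcW _ h2
    · have : y₂ * w 4 = d * 1 - y₁ ^ 2 := by simp [hw, hd, pow_two]
      change y₂ * w 4 ∈ W
      rw [this]
      exact sub_mem (hdW _ h0) h2
  have gen : ∀ g, SkewCommute k g c → SkewCommute k g d → (∀ e, g * w e ∈ W) →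
      ∀ v ∈ W, g * v ∈ W := by
    intro g hgc hgd hg
    change W ≤ W.comap (LinearMap.mulLeft k g)
    conv_lhs => rw [hW]
    rw [Submodule.span_le]
    rintro _ ⟨⟨⟨i, j⟩, e⟩, rfl⟩
    obtain ⟨u, hu⟩ := skewCommute_iff.1 ((hgc.pow_right i).mul_right (hgd.pow_right j))
    simp only [SetLike.mem_coe, Submodule.mem_comap, LinearMap.mulLeft_apply]
    rw [← mul_assoc, hu, smul_mul_assoc, mul_assoc _ g]
    exact Submodule.smul_of_tower_mem _ _ (hcdW _ _ _ (hg e))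
  refine Algebra.toSubmodule_adjoin_le h0 ?_
  intro g hg
  obtain rfl | rfl := hg
  · exact gen _ (.of_eq_neg (left_mul_prod_eq_neg hy)) (.of_commute (commute_left_sq_add_sq hy)) g1
  · exact gen _ (.of_eq_neg (right_mul_prod_eq_neg hy))
      (.of_commute (commute_right_sq_add_sq hy)) g2

end SkewPair

namespace BhGenerators

variable {k A : Type*} [Field k] [Ring A] [Algebra k A] {h : k} {x₁ x₂ y₁ y₂ : A}

lemma adjoin_mul_adjoin_eq_top (H : BhGenerators h x₁ x₂ y₁ y₂) :
    Subalgebra.toSubmodule (Algebra.adjoin k {x₁, x₂}) *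
      Subalgebra.toSubmodule (Algebra.adjoin k {y₁, y₂}) = ⊤ := by
  set P := Algebra.adjoin k {x₁, x₂} with hP
  set Q := Algebra.adjoin k {y₁, y₂} with hQ
  set Y := Submodule.span k {y₁, y₂} with hY
  have hx₁ : x₁ ∈ P := Algebra.subset_adjoin (by simp)
  have hx₂ : x₂ ∈ P := Algebra.subset_adjoin (by simp)
  have hy₁ : y₁ ∈ Y := Submodule.subset_span (by simp)
  have hy₂ : y₂ ∈ Y := Submodule.subset_span (by simp)
  have hYQ : Y ≤ Subalgebra.toSubmodule Q := Algebra.span_le_adjoin _ _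
  have hPPY : Subalgebra.toSubmodule P * (Subalgebra.toSubmodule P * Y)
      ≤ Subalgebra.toSubmodule P * Y := by
    rw [← mul_assoc, (Subalgebra.isIdempotentElem_toSubmodule P).eq]
  have of_gens : ∀ {p : A} {N : Submodule k A}, y₁ * p ∈ N → y₂ * p ∈ N →
      ∀ y ∈ Y, y * p ∈ N := by
    intro p N h1 h2
    change Y ≤ N.comap (LinearMap.mulRight k p)
    rw [hY, Submodule.span_le]
    rintro _ (rfl | rfl)
    · exact h1
    · exact h2
  have xy : ∀ {x y : A}, x ∈ P → y ∈ Y → x * y ∈ Subalgebra.toSubmodule P * Y :=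
    fun hx hy => Submodule.mul_mem_mul hx hy
  have hYP : ∀ p ∈ P, ∀ y ∈ Y, y * p ∈ Subalgebra.toSubmodule P * Y := by
    intro p hp
    induction hp using Algebra.adjoin_induction with
    | mem g hg =>
      obtain rfl | rfl := hg
      · refine of_gens ?_ ?_
        · rw [H.y₁_mul_x₁]
          exact Submodule.smul_mem _ _
            (add_mem (add_mem (xy hx₁ hy₁) (xy hx₂ hy₁)) (xy hx₁ hy₂))
        · rw [H.y₂_mul_x₁]
          exact Submodule.smul_mem _ _ (xy hx₂ hy₁)
      · refine of_gens ?_ ?_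
        · rw [H.y₁_mul_x₂]
          exact Submodule.smul_mem _ _ (xy hx₁ hy₂)
        · rw [H.y₂_mul_x₂]
          exact Submodule.smul_mem _ _
            (add_mem (sub_mem (neg_mem (xy hx₂ hy₁)) (xy hx₁ hy₂)) (xy hx₂ hy₂))
    | algebraMap r =>
      intro y hy
      rw [← Algebra.commutes]
      exact xy (Subalgebra.algebraMap_mem _ r) hy
    | add p q _ _ hp hq =>
      intro y hy
      rw [mul_add]
      exact add_mem (hp y hy) (hq y hy)
    | mul p q _ _ hp hq =>
      intro y hy
      rw [← mul_assoc]
      have : Subalgebra.toSubmodule P * Y ≤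
          (Subalgebra.toSubmodule P * Y).comap (LinearMap.mulRight k q) := by
        rw [Submodule.mul_le]
        intro p' hp' y' hy'
        rw [Submodule.mem_comap, LinearMap.mulRight_apply, mul_assoc]
        exact hPPY (Submodule.mul_mem_mul hp' (hq y' hy'))
      exact this (hp y hy)
  have hYPQ : ∀ y ∈ Y, ∀ v ∈ Subalgebra.toSubmodule P * Subalgebra.toSubmodule Q,
      y * v ∈ Subalgebra.toSubmodule P * Subalgebra.toSubmodule Q := by
    intro y hy v hv
    have h1 : Y * Subalgebra.toSubmodule P ≤ Subalgebra.toSubmodule P * Y :=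
      Submodule.mul_le.2 fun y hy p hp => hYP p hp y hy
    have h2 : Y * (Subalgebra.toSubmodule P * Subalgebra.toSubmodule Q) ≤
        Subalgebra.toSubmodule P * Subalgebra.toSubmodule Q := by
      calc Y * (Subalgebra.toSubmodule P * Subalgebra.toSubmodule Q)
          = Y * Subalgebra.toSubmodule P * Subalgebra.toSubmodule Q := (mul_assoc _ _ _).symm
        _ ≤ Subalgebra.toSubmodule P * Y * Subalgebra.toSubmodule Q := mul_le_mul_left h1 _
        _ = Subalgebra.toSubmodule P * (Y * Subalgebra.toSubmodule Q) := mul_assoc _ _ _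
        _ ≤ Subalgebra.toSubmodule P *
            (Subalgebra.toSubmodule Q * Subalgebra.toSubmodule Q) :=
          mul_le_mul_right (mul_le_mul_left hYQ _) _
        _ = _ := by rw [(Subalgebra.isIdempotentElem_toSubmodule Q).eq]
    exact h2 (Submodule.mul_mem_mul hy hv)
  have hPPQ : ∀ x ∈ P, ∀ v ∈ Subalgebra.toSubmodule P * Subalgebra.toSubmodule Q,
      x * v ∈ Subalgebra.toSubmodule P * Subalgebra.toSubmodule Q := by
    intro x hx v hv
    have := Submodule.mul_mem_mul (show x ∈ Subalgebra.toSubmodule P from hx) hv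
    rwa [← mul_assoc, (Subalgebra.isIdempotentElem_toSubmodule P).eq] at this
  rw [← top_le_iff, ← Algebra.top_toSubmodule, ← H.adjoin_eq_top]
  refine Algebra.toSubmodule_adjoin_le ?_ ?_
  · simpa using Submodule.mul_mem_mul (show (1 : A) ∈ Subalgebra.toSubmodule P from P.one_mem)
      (show (1 : A) ∈ Subalgebra.toSubmodule Q from Q.one_mem)
  · rintro g (rfl | rfl | rfl | rfl)
    · exact hPPQ _ hx₁
    · exact hPPQ _ hx₂
    · exact hYPQ _ hy₁
    · exact hYPQ _ hy₂

theorem isNoetherianRing (H : BhGenerators h x₁ x₂ y₁ y₂) (hh : h ≠ 0) : IsNoetherianRing A := by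
  have hh2 : h ^ 2 ≠ 0 := pow_ne_zero 2 hh
  set c := y₁ * y₂ with hc
  set d := y₁ ^ 2 + y₂ ^ 2 with hd
  have h21 : SkewCommute k x₂ x₁ := .of_eq_neg H.x₂_mul_x₁
  have hc1 : SkewCommute k c x₁ :=
    .of_eq_smul (neg_ne_zero.2 hh2) (by rw [H.y₁_mul_y₂_mul_x₁, neg_smul])
  have hc2 : SkewCommute k c x₂ :=
    .of_eq_smul (neg_ne_zero.2 hh2) (by rw [H.y₁_mul_y₂_mul_x₂, neg_smul])
  have hd1 : SkewCommute k d x₁ := .of_eq_smul hh2 H.sq_add_sq_mul_x₁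
  have hd2 : SkewCommute k d x₂ := .of_eq_smul hh2 H.sq_add_sq_mul_x₂
  have hdc : SkewCommute k d c :=
    (SkewCommute.of_commute (commute_left_sq_add_sq H.y₂_mul_y₁).symm).mul_right
      (.of_commute (commute_right_sq_add_sq H.y₂_mul_y₁).symm)
  refine isNoetherianRing_of_monomials (k := k) (ε := Fin 5)
    (fun α : Fin 4 → ℕ => x₁ ^ α 0 * x₂ ^ α 1 * (c ^ α 2 * d ^ α 3))
    ![1, y₁, y₁ ^ 2, y₁ ^ 3, y₂] ?_ ?_
  · intro α β
    refine (scalarCon k A).eq.1 ?_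
    have k1 : Commute _ _ := h21.pow_pow (α 1) (β 0)
    have k2 : Commute _ _ := hdc.pow_pow (α 3) (β 2)
    have k3 := (Commute.mul_left (hc1.pow_pow (α 2) (β 0)) (hd1.pow_pow (α 3) (β 0))).mul_right
      (Commute.mul_left (hc2.pow_pow (α 2) (β 1)) (hd2.pow_pow (α 3) (β 1)))
    simp only [Con.coe_mul, Pi.add_apply, pow_add]
    rw [k3.mul_mul_mul_comm, k1.mul_mul_mul_comm, k2.mul_mul_mul_comm]
  · rw [← top_le_iff, ← H.adjoin_mul_adjoin_eq_top]
    refine (mul_le_mul' (adjoin_pair_le_span_monomials k H.x₂_mul_x₁)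
      (adjoin_pair_le_span_central_monomials k H.y₂_mul_y₁)).trans ?_
    rw [Submodule.span_mul_span]
    refine Submodule.span_mono ?_
    rintro _ ⟨_, ⟨⟨i, j⟩, rfl⟩, _, ⟨⟨⟨l, m⟩, e⟩, rfl⟩, rfl⟩
    exact ⟨(![i, j, l, m], e), by simp [mul_assoc, hc, hd]⟩

theorem normal (H : BhGenerators h x₁ x₂ y₁ y₂) (hh : h ≠ 0) {z : A}
    (hz : z ∈ ({x₁ * x₂, x₁ ^ 2 + x₂ ^ 2, y₁ * y₂, y₁ ^ 2 + y₂ ^ 2} : Set A)) :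
    {w : A | ∃ b, w = z * b} = {w : A | ∃ b, w = b * z} := by
  have hh2 : h ^ 2 ≠ 0 := pow_ne_zero 2 hh
  refine exists_mul_eq_mul_of_skewCommute H.adjoin_eq_top ?_
  obtain rfl | rfl | rfl | rfl := hz
  · rintro g (rfl | rfl | rfl | rfl)
    · exact (SkewCommute.of_eq_neg (left_mul_prod_eq_neg H.x₂_mul_x₁)).symm
    · exact (SkewCommute.of_eq_neg (right_mul_prod_eq_neg H.x₂_mul_x₁)).symm
    · exact (SkewCommute.of_eq_smul (neg_ne_zero.2 hh2)
        (by rw [H.y₁_mul_x₁_mul_x₂, neg_smul])).symm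
    · exact (SkewCommute.of_eq_smul (neg_ne_zero.2 hh2)
        (by rw [H.y₂_mul_x₁_mul_x₂, neg_smul])).symm
  · rintro g (rfl | rfl | rfl | rfl)
    · exact (SkewCommute.of_commute (commute_left_sq_add_sq H.x₂_mul_x₁)).symm
    · exact (SkewCommute.of_commute (commute_right_sq_add_sq H.x₂_mul_x₁)).symm
    · exact (SkewCommute.of_eq_smul hh2 H.y₁_mul_sq_add_sq).symm
    · exact (SkewCommute.of_eq_smul hh2 H.y₂_mul_sq_add_sq).symm
  · rintro g (rfl | rfl | rfl | rfl)
    · exact .of_eq_smul (neg_ne_zero.2 hh2) (by rw [H.y₁_mul_y₂_mul_x₁, neg_smul])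
    · exact .of_eq_smul (neg_ne_zero.2 hh2) (by rw [H.y₁_mul_y₂_mul_x₂, neg_smul])
    · exact (SkewCommute.of_eq_neg (left_mul_prod_eq_neg H.y₂_mul_y₁)).symm
    · exact (SkewCommute.of_eq_neg (right_mul_prod_eq_neg H.y₂_mul_y₁)).symm
  · rintro g (rfl | rfl | rfl | rfl)
    · exact .of_eq_smul hh2 H.sq_add_sq_mul_x₁
    · exact .of_eq_smul hh2 H.sq_add_sq_mul_x₂
    · exact (SkewCommute.of_commute (commute_left_sq_add_sq H.y₂_mul_y₁)).symm
    · exact (SkewCommute.of_commute (commute_right_sq_add_sq H.y₂_mul_y₁)).symm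

end BhGenerators

lemma bhGenerators (k : Type*) [Field k] (h : k) :
    BhGenerators h (bX₁ k h) (bX₂ k h) (bY₁ k h) (bY₂ k h) := by
  have rel : ∀ {a b}, bhRel k h a b →
      RingQuot.mkAlgHom k (bhRel k h) a = RingQuot.mkAlgHom k (bhRel k h) b :=
    fun hab => RingQuot.mkAlgHom_rel k hab
  unfold bX₁ bX₂ bY₁ bY₂
  constructor
  · simpa only [map_mul, map_neg] using rel (.inl ⟨rfl, rfl⟩)
  · simpa only [map_mul, map_neg] using rel (.inr (.inl ⟨rfl, rfl⟩))
  · simpa only [map_mul, map_add, map_smul] using rel (.inr (.inr (.inl ⟨rfl, rfl⟩)))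
  · simpa only [map_mul, map_smul] using rel (.inr (.inr (.inr (.inl ⟨rfl, rfl⟩))))
  · simpa only [map_mul, map_smul] using rel (.inr (.inr (.inr (.inr (.inl ⟨rfl, rfl⟩)))))
  · simpa only [map_mul, map_neg, map_sub, map_add, map_smul] using
      rel (.inr (.inr (.inr (.inr (.inr ⟨rfl, rfl⟩)))))
  · rw [← (AlgHom.range_eq_top _).2 (RingQuot.mkAlgHom_surjective k (bhRel k h)),
      ← Algebra.map_top, ← FreeAlgebra.adjoin_range_ι, AlgHom.map_adjoin, ← Set.range_comp]
    congr 1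
    ext z
    simp [Fin.exists_fin_succ, eq_comm]

/-- Each of `x₁x₂`, `x₁² + x₂²`, `y₁y₂`, `y₁² + y₂²` is a normal element of `B(h)`
(`zB = Bz`); explicitly `y₁(x₁x₂) = −h²(x₁x₂)y₁`, `y₂(x₁x₂) = −h²(x₁x₂)y₂`,
`y₁(x₁²+x₂²) = h²(x₁²+x₂²)y₁`, `y₂(x₁²+x₂²) = h²(x₁²+x₂²)y₂`.  Moreover `B(h)` is
left and right noetherian. -/
theorem Bh_normal_elements_noetherian (k : Type*) [Field k] (h : k) (hh : h ≠ 0) :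
    (∀ z ∈ ({bX₁ k h * bX₂ k h, bX₁ k h ^ 2 + bX₂ k h ^ 2,
             bY₁ k h * bY₂ k h, bY₁ k h ^ 2 + bY₂ k h ^ 2} : Set (Bh k h)),
      {w : Bh k h | ∃ b, w = z * b} = {w : Bh k h | ∃ b, w = b * z}) ∧
    (bY₁ k h * (bX₁ k h * bX₂ k h) = -((h ^ 2) • (bX₁ k h * bX₂ k h * bY₁ k h))) ∧
    (bY₂ k h * (bX₁ k h * bX₂ k h) = -((h ^ 2) • (bX₁ k h * bX₂ k h * bY₂ k h))) ∧
    (bY₁ k h * (bX₁ k h ^ 2 + bX₂ k h ^ 2) =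
      (h ^ 2) • ((bX₁ k h ^ 2 + bX₂ k h ^ 2) * bY₁ k h)) ∧
    (bY₂ k h * (bX₁ k h ^ 2 + bX₂ k h ^ 2) =
      (h ^ 2) • ((bX₁ k h ^ 2 + bX₂ k h ^ 2) * bY₂ k h)) ∧
    IsNoetherianRing (Bh k h) ∧ IsNoetherianRing (Bh k h)ᵐᵒᵖ := by
  have H := bhGenerators k h
  exact ⟨fun z hz => H.normal hh hz, H.y₁_mul_x₁_mul_x₂, H.y₂_mul_x₁_mul_x₂,
    H.y₁_mul_sq_add_sq, H.y₂_mul_sq_add_sq, H.isNoetherianRing hh, H.op.isNoetherianRing hh⟩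
end

section
/- B(h) has no nonzero normal element of degree one: if z = a·x₁ + b·x₂ + c·y₁ + d·y₂ in B(h) with a, b, c, d ∈ k and z·B(h) = B(h)·z as subsets of B(h), then z = 0. -/
/-- The multiplication of degree-one elements of `B(h)`, where the coordinates in degree two are
taken with respect to the basis
`x₁², x₁x₂, x₂², y₁², y₁y₂, y₂², x₁y₁, x₁y₂, x₂y₁, x₂y₂`. -/
def bhDegreeOneMul {k : Type*} [Field k] (h : k) :
    (Fin 4 → k) →ₗ[k] (Fin 4 → k) →ₗ[k] (Fin 10 → k) :=
  LinearMap.mk₂ k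
    (fun p q => ![p 0 * q 0, p 0 * q 1 - p 1 * q 0, p 1 * q 1,
      p 2 * q 2, p 2 * q 3 - p 3 * q 2, p 3 * q 3,
      p 0 * q 2 + h * (p 2 * q 0),
      p 0 * q 3 + h * (p 2 * q 0 + p 2 * q 1 - p 3 * q 1),
      p 1 * q 2 + h * (p 2 * q 0 + p 3 * q 0 - p 3 * q 1),
      p 1 * q 3 + h * (p 3 * q 1)])
    (fun _ _ _ => by ext i; fin_cases i <;> simp <;> ring)
    (fun _ _ _ => by ext i; fin_cases i <;> simp <;> ring)
    (fun _ _ _ => by ext i; fin_cases i <;> simp <;> ring)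
    (fun _ _ _ => by ext i; fin_cases i <;> simp <;> ring)

/-- Right multiplication by a degree-one element on `B(h)` truncated above degree two. -/
def bhRightMul {k : Type*} [Field k] (h : k) :
    (Fin 4 → k) →ₗ[k] Module.End k (k × (Fin 4 → k) × (Fin 10 → k)) :=
  LinearMap.mk₂ k (fun q m => (0, m.1 • q, bhDegreeOneMul h m.2.1 q))
    (fun _ _ _ => by simp) (fun c q m => by simp [smul_comm c m.1])
    (fun _ _ _ => by simp [add_smul]) (fun _ _ _ => by simp [mul_smul])

lemma bhRightMul_apply {k : Type*} [Field k] (h : k) (q : Fin 4 → k)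
    (m : k × (Fin 4 → k) × (Fin 10 → k)) :
    bhRightMul h q m = (0, m.1 • q, bhDegreeOneMul h m.2.1 q) := rfl

lemma bhRightMul_bhRightMul {k : Type*} [Field k] (h : k) (p q : Fin 4 → k)
    (m : k × (Fin 4 → k) × (Fin 10 → k)) :
    bhRightMul h q (bhRightMul h p m) = (0, 0, m.1 • bhDegreeOneMul h p q) := by
  simp [bhRightMul_apply]

/-- The images of the generators of `B(h)` under its right action on the truncation above degree
two. -/
def bhGenAction {k : Type*} [Field k] (h : k) (i : Fin 4) :
    (Module.End k (k × (Fin 4 → k) × (Fin 10 → k)))ᵐᵒᵖ :=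
  MulOpposite.op (bhRightMul h (Pi.single i 1))

lemma unop_bhGenAction_mul_apply {k : Type*} [Field k] (h : k) (i j : Fin 4)
    (m : k × (Fin 4 → k) × (Fin 10 → k)) :
    (bhGenAction h i * bhGenAction h j).unop m =
      (0, 0, m.1 • bhDegreeOneMul h (Pi.single i 1) (Pi.single j 1)) :=
  bhRightMul_bhRightMul h _ _ m

lemma bhRel_lift_bhGenAction {k : Type*} [Field k] {h : k} ⦃s t : FreeAlgebra k (Fin 4)⦄
    (hst : bhRel k h s t) :
    FreeAlgebra.lift k (bhGenAction h) s = FreeAlgebra.lift k (bhGenAction h) t := by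
  rcases hst with ⟨rfl, rfl⟩ | ⟨rfl, rfl⟩ | ⟨rfl, rfl⟩ | ⟨rfl, rfl⟩ | ⟨rfl, rfl⟩ | ⟨rfl, rfl⟩ <;>
  · simp only [map_mul, map_neg, map_smul, map_add, map_sub, FreeAlgebra.lift_ι_apply]
    refine MulOpposite.unop_injective (LinearMap.ext fun m => ?_)
    simp only [MulOpposite.unop_neg, MulOpposite.unop_smul, MulOpposite.unop_add,
      MulOpposite.unop_sub, LinearMap.neg_apply, LinearMap.smul_apply, LinearMap.add_apply,
      LinearMap.sub_apply, unop_bhGenAction_mul_apply, Prod.smul_mk, Prod.mk_add_mk,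
      Prod.mk_sub_mk, Prod.neg_mk, smul_zero, neg_zero, add_zero, sub_zero,
      ← smul_add, ← smul_sub, ← smul_neg, smul_comm h m.1]
    congr 3
    ext n
    fin_cases n <;> simp [bhDegreeOneMul]

/-- The right action of `B(h)` on its truncation above degree two. -/
def bhRightAction (k : Type*) [Field k] (h : k) :
    Bh k h →ₐ[k] (Module.End k (k × (Fin 4 → k) × (Fin 10 → k)))ᵐᵒᵖ :=
  RingQuot.liftAlgHom k ⟨FreeAlgebra.lift k (bhGenAction h), bhRel_lift_bhGenAction⟩

lemma unop_bhRightAction_degree_one {k : Type*} [Field k] (h : k) (q : Fin 4 → k) :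
    (bhRightAction k h (q 0 • bX₁ k h + q 1 • bX₂ k h + q 2 • bY₁ k h + q 3 • bY₂ k h)).unop =
      bhRightMul h q := by
  have hq : q = q 0 • Pi.single 0 1 + q 1 • Pi.single 1 1 + q 2 • Pi.single 2 1
      + q 3 • Pi.single 3 1 := by
    ext i; fin_cases i <;> simp
  conv_rhs => rw [hq]
  simp [bhRightAction, bhGenAction, bX₁, bX₂, bY₁, bY₂]

/-- An identity `z * q = u * z` in `B(h)`, with `z` and `q` of degree one, remains true in degree
two when `u` is replaced by its degree-one component. -/
lemma exists_bhDegreeOneMul_eq {k : Type*} [Field k] {h : k} {z q : Fin 4 → k} {u : Bh k h}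
    (hu : (z 0 • bX₁ k h + z 1 • bX₂ k h + z 2 • bY₁ k h + z 3 • bY₂ k h) *
        (q 0 • bX₁ k h + q 1 • bX₂ k h + q 2 • bY₁ k h + q 3 • bY₂ k h) =
      u * (z 0 • bX₁ k h + z 1 • bX₂ k h + z 2 • bY₁ k h + z 3 • bY₂ k h)) :
    ∃ p, bhDegreeOneMul h z q = bhDegreeOneMul h p z := by
  have key := congrArg (fun w => ((bhRightAction k h w).unop (1, 0, 0)).2.2) hu
  simp only [map_mul, MulOpposite.unop_mul, Module.End.mul_apply,
    unop_bhRightAction_degree_one, bhRightMul_apply, one_smul] at key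
  exact ⟨_, key⟩

/-- `B(h)` has no nonzero normal element of degree one: if a `k`-linear combination
`z = ax₁ + bx₂ + cy₁ + dy₂` satisfies `zB(h) = B(h)z`, then `z = 0`. -/
theorem Bh_no_normal_degree_one (k : Type*) [Field k] (hchar : (2 : k) ≠ 0)
    (h : k) (hh : h ≠ 0) (a b c d : k)
    (hnormal :
      {w : Bh k h | ∃ u, w = (a • bX₁ k h + b • bX₂ k h + c • bY₁ k h + d • bY₂ k h) * u} =
      {w : Bh k h | ∃ u, w = u * (a • bX₁ k h + b • bX₂ k h + c • bY₁ k h + d • bY₂ k h)}) :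
    a • bX₁ k h + b • bX₂ k h + c • bY₁ k h + d • bY₂ k h = 0 := by
  have hex : ∀ q, ∃ p, bhDegreeOneMul h ![a, b, c, d] q = bhDegreeOneMul h p ![a, b, c, d] := by
    intro q
    obtain ⟨u, hu⟩ := hnormal.subset
      ⟨q 0 • bX₁ k h + q 1 • bX₂ k h + q 2 • bY₁ k h + q 3 • bY₂ k h, rfl⟩
    exact exists_bhDegreeOneMul_eq (u := u) (by simpa using hu)
  have hX := hex ![1, 0, 0, 0]
  have hY := hex ![0, 0, 1, 0]
  have hzero : a = 0 ∧ b = 0 ∧ c = 0 ∧ d = 0 := by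
    obtain ⟨p, hp⟩ := hX
    obtain ⟨r, hr⟩ := hY
    simp [bhDegreeOneMul] at hp hr
    obtain ⟨p1, p2, p3, p4, p5, p6, p7, p8, p9, p10⟩ := hp
    obtain ⟨r1, r2, r3, r4, r5, r6, r7, r8, r9, r10⟩ := hr
    have hab : b = 0 ∨ a = 0 := by
      by_contra! hne
      have : p 1 = 0 := p3.resolve_right hne.1
      have : (2 : k) * (a * b) = 0 := by grind
      exact mul_ne_zero hchar (mul_ne_zero hne.2 hne.1) this
    have hcd : c = 0 ∨ d = 0 := by
      by_contra! hne
      have : r 3 = 0 := r6.resolve_right hne.2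
      have : (2 : k) * (c * d) = 0 := by grind
      exact mul_ne_zero hchar (mul_ne_zero hne.1 hne.2) this
    have hc : c = 0 := by
      by_contra hne
      grind
    have hd : d = 0 := by
      by_contra hne
      grind
    subst hc hd
    have ha : a = 0 := by
      by_contra hne
      grind
    have hb : b = 0 := by
      by_contra hne
      grind
    exact ⟨ha, hb, rfl, rfl⟩
  obtain ⟨rfl, rfl, rfl, rfl⟩ := hzero
  simp
end
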